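/- Let μ be an Ising model on {0,1}^S (S a finite set, possibly after pinning a subset A) with Hamiltonian Σ_{(u,v)∈E} β_{uv} σ_u σ_v + Σ_u h_u σ_u, where each |β_{uv}| ≤ β, on a graph of maximal degree at most Δ. If β ≤ 1/Δ, then μ satisfies approximate tensorization of variance with constant 2 and approximate tensorization of entropy with constant 2. -/

import Mathlib

open scoped BigOperators

noncomputable section

/-- Numerical value of a Boolean spin in `{0,1}`. -/
def bval (b : Bool) : ℝ := if b then 1 else 0

variable {V : Type*} [Fintype V] [DecidableEq V]

/-- Mean of `f` under the (finitely supported) probability vector `p`. -/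
def pMean (p f : (V → Bool) → ℝ) : ℝ := ∑ σ, p σ * f σ

/-- Variance of `f` under `p`. -/
def pVar (p f : (V → Bool) → ℝ) : ℝ := pMean p (fun σ => (f σ - pMean p f) ^ 2)

/-- Conditional mean of `f` given all coordinates except `i` (evaluated at `σ`). -/
def condMean (p f : (V → Bool) → ℝ) (i : V) (σ : V → Bool) : ℝ :=
  (∑ b, p (Function.update σ i b) * f (Function.update σ i b)) /
    (∑ b, p (Function.update σ i b))

/-- `E_p[Var_p(f | X_{-i})]`, the single-site conditional variance term. -/
def siteVarTerm (p f : (V → Bool) → ℝ) (i : V) : ℝ :=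
  ∑ σ, p σ * (f σ - condMean p f i σ) ^ 2

/-- Entropy `Ent_p(f) = E_p[f log f] − E_p[f] log E_p[f]`. -/
def pEnt (p f : (V → Bool) → ℝ) : ℝ :=
  pMean p (fun σ => f σ * Real.log (f σ)) - pMean p f * Real.log (pMean p f)

/-- `E_p[Ent_p(f | X_{-i})]`, the single-site conditional entropy term. -/
def siteEntTerm (p f : (V → Bool) → ℝ) (i : V) : ℝ :=
  ∑ σ, p σ * (f σ * Real.log (f σ)
    - condMean p f i σ * Real.log (condMean p f i σ))

section Helpers

set_option linter.unusedSectionVars false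

/-! ### Nonnegativity of weighted quadratic forms from their spectrum -/

/-- A linear map symmetric for a positive weight and without negative eigenvalues has a
nonnegative quadratic form. -/
lemma weighted_form_nonneg {Ω : Type*} [Fintype Ω] [DecidableEq Ω] {w : Ω → ℝ}
    (hw : ∀ x, 0 < w x) (T : (Ω → ℝ) →ₗ[ℝ] (Ω → ℝ))
    (hsym : ∀ f g : Ω → ℝ, ∑ x, w x * (f x * T g x) = ∑ x, w x * (T f x * g x))
    (heig : ∀ κ : ℝ, κ < 0 → ∀ f, T f = κ • f → f = 0) (f : Ω → ℝ) :
    0 ≤ ∑ x, w x * (f x * T f x) := by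
  have hs : ∀ x, 0 < √(w x) := fun x => Real.sqrt_pos.2 (hw x)
  have hss : ∀ x, √(w x) * √(w x) = w x := fun x => Real.mul_self_sqrt (hw x).le
  set M : Matrix Ω Ω ℝ := LinearMap.toMatrix' T with hM
  have hTM : ∀ g x, T g x = ∑ y, M x y * g y := fun g x => by
    rw [← Matrix.toLin'_toMatrix' T, Matrix.toLin'_apply]
    simp [Matrix.mulVec, dotProduct, hM]
  set N : Matrix Ω Ω ℝ := Matrix.of fun x y => √(w x) * M x y / √(w y) with hN
  have hMsym : ∀ x y, w x * M x y = w y * M y x := fun x y => by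
    have := hsym (Pi.single x 1) (Pi.single y 1)
    simpa [hTM, Pi.single_apply] using this
  have hherm : N.IsHermitian := by
    ext x y
    simp only [hN, Matrix.conjTranspose_apply, Matrix.of_apply, star_trivial]
    rw [div_eq_div_iff (hs x).ne' (hs y).ne']
    linear_combination -hMsym x y + M y x * hss y - M x y * hss x
  have hNmul : ∀ g x, N.mulVec g x = √(w x) * T (fun y => g y / √(w y)) x := fun g x => by
    simp only [hN, Matrix.mulVec, dotProduct, Matrix.of_apply, hTM, Finset.mul_sum]
    exact Finset.sum_congr rfl fun y _ => by ring
  have hpos : N.PosSemidef := by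
    rw [hherm.posSemidef_iff_eigenvalues_nonneg]
    intro j
    by_contra hneg
    simp only [Pi.zero_apply, not_le] at hneg
    have hev := hherm.mulVec_eigenvectorBasis j
    set g : Ω → ℝ := ⇑(hherm.eigenvectorBasis j) with hg
    have hz : (fun y => g y / √(w y)) = 0 := by
      refine heig (hherm.eigenvalues j) hneg _ ?_
      ext x
      have h1 := congrFun hev x
      rw [hNmul] at h1
      simp only [Pi.smul_apply, smul_eq_mul] at h1 ⊢
      rw [← mul_div_assoc, eq_div_iff (hs x).ne', ← h1, mul_comm]
    have hg0 : hherm.eigenvectorBasis j = 0 := by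
      ext x
      have h1 := congrFun hz x
      simpa [(hs x).ne'] using h1
    have hn := hherm.eigenvectorBasis.orthonormal.1 j
    rw [hg0, norm_zero] at hn
    exact zero_ne_one hn
  have h1 := hpos.dotProduct_mulVec_nonneg (fun x => √(w x) * f x)
  have h2 : (fun y => √(w y) * f y / √(w y)) = f := by
    ext y; field_simp [(hs y).ne']
  simp only [dotProduct, hNmul, h2, Pi.star_apply, star_trivial] at h1
  refine h1.trans_eq (Finset.sum_congr rfl fun x _ => ?_)
  linear_combination f x * T f x * hss x

/-! ### Single-site conditional expectations -/

lemma sum_update_eq_two_mul (g : (V → Bool) → ℝ) (i : V) :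
    ∑ σ, ∑ b, g (Function.update σ i b) = 2 * ∑ σ, g σ := by
  have hflip : ∑ σ, g (Function.update σ i (!σ i)) = ∑ σ, g σ := by
    have hinv : Function.Involutive fun σ : V → Bool => Function.update σ i (!σ i) := by
      intro σ; simp
    exact Equiv.sum_comp (hinv.toPerm _) g
  have hsplit : ∀ σ : V → Bool, ∑ b, g (Function.update σ i b)
      = g σ + g (Function.update σ i (!σ i)) := by
    intro σ
    have hσ := Function.update_eq_self i σ
    rw [Fintype.sum_bool]
    cases hi : σ i <;> rw [hi] at hσ <;> simp [hσ, add_comm]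
  simp_rw [hsplit, Finset.sum_add_distrib, hflip, two_mul]

lemma condMean_update (w f : (V → Bool) → ℝ) (i : V) (σ : V → Bool) (b : Bool) :
    condMean w f i (Function.update σ i b) = condMean w f i σ := by
  simp [condMean]

lemma condMean_smul_weight {c : ℝ} (hc : c ≠ 0) (w f : (V → Bool) → ℝ) (i : V) :
    condMean (fun σ => c * w σ) f i = condMean w f i := by
  ext σ
  simp only [condMean, mul_assoc, ← Finset.mul_sum]
  exact mul_div_mul_left _ _ hc

lemma sum_bool_pos {w : (V → Bool) → ℝ} (hw : ∀ σ, 0 < w σ) (i : V) (σ : V → Bool) :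
    0 < ∑ b, w (Function.update σ i b) :=
  Finset.sum_pos (fun _ _ => hw _) Finset.univ_nonempty

/-- The tower property: a factor not depending on the spin at `i` passes through `condMean`. -/
lemma sum_mul_condMean {w : (V → Bool) → ℝ} (hw : ∀ σ, 0 < w σ) (i : V)
    {c : (V → Bool) → ℝ} (hc : ∀ σ b, c (Function.update σ i b) = c σ) (f : (V → Bool) → ℝ) :
    ∑ σ, w σ * (c σ * condMean w f i σ) = ∑ σ, w σ * (c σ * f σ) := by
  suffices h : 2 * ∑ σ, w σ * (c σ * condMean w f i σ) = 2 * ∑ σ, w σ * (c σ * f σ) by linarith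
  rw [← sum_update_eq_two_mul _ i, ← sum_update_eq_two_mul _ i]
  refine Finset.sum_congr rfl fun σ _ => ?_
  simp_rw [hc, condMean_update]
  have hD := (sum_bool_pos hw i σ).ne'
  have h1 : condMean w f i σ * ∑ b, w (Function.update σ i b)
      = ∑ b, w (Function.update σ i b) * f (Function.update σ i b) := div_mul_cancel₀ _ hD
  calc ∑ b, w (Function.update σ i b) * (c σ * condMean w f i σ)
      = c σ * (condMean w f i σ * ∑ b, w (Function.update σ i b)) := by
        rw [← Finset.sum_mul]; ring
    _ = _ := by
        rw [h1, Finset.mul_sum]; exact Finset.sum_congr rfl fun b _ => by ring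

/-- Conditional expectation given all spins but the one at `i`, as a linear map. -/
def condMeanLin (w : (V → Bool) → ℝ) (i : V) : ((V → Bool) → ℝ) →ₗ[ℝ] ((V → Bool) → ℝ) where
  toFun f := condMean w f i
  map_add' f g := by
    ext σ; simp only [condMean, Pi.add_apply, mul_add, Finset.sum_add_distrib, add_div]
  map_smul' c f := by
    ext σ
    simp only [condMean, Pi.smul_apply, smul_eq_mul, RingHom.id_apply, ← mul_div_assoc,
      Finset.mul_sum, mul_left_comm]

lemma sum_condMean_mul_condMean {w : (V → Bool) → ℝ} (hw : ∀ σ, 0 < w σ) (i : V)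
    (f g : (V → Bool) → ℝ) :
    ∑ σ, w σ * (condMean w f i σ * condMean w g i σ) = ∑ σ, w σ * (condMean w f i σ * g σ) :=
  sum_mul_condMean hw i (condMean_update w f i) g

lemma sum_condMean_mul_comm {w : (V → Bool) → ℝ} (hw : ∀ σ, 0 < w σ) (i : V)
    (f g : (V → Bool) → ℝ) :
    ∑ σ, w σ * (f σ * condMean w g i σ) = ∑ σ, w σ * (condMean w f i σ * g σ) := by
  rw [← sum_condMean_mul_condMean hw i f g]
  have := sum_condMean_mul_condMean hw i g f
  simp only [mul_comm (condMean w g i _)] at this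
  exact this.symm

lemma siteVarTerm_eq {w : (V → Bool) → ℝ} (hw : ∀ σ, 0 < w σ) (i : V) (f : (V → Bool) → ℝ) :
    siteVarTerm w f i = ∑ σ, w σ * (f σ * (f σ - condMean w f i σ)) := by
  have h := sum_condMean_mul_condMean hw i f f
  rw [siteVarTerm, ← sub_eq_zero, ← Finset.sum_sub_distrib]
  rw [← sub_eq_zero, ← Finset.sum_sub_distrib] at h
  rw [← h]
  exact Finset.sum_congr rfl fun σ _ => by ring

/-! ### Approximate tensorization of variance under a Dobrushin condition -/

lemma eq_of_forall_update_eq {α : Type*} {f : (V → Bool) → α}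
    (hf : ∀ j σ b, f (Function.update σ j b) = f σ) (σ τ : V → Bool) : f σ = f τ := by
  have h : ∀ s : Finset V, f (s.piecewise τ σ) = f σ := by
    intro s
    induction s using Finset.induction_on with
    | empty => simp
    | insert j s _ ih => rw [Finset.piecewise_insert, hf, ih]
  simpa using (h Finset.univ).symm

/-- Conditional probability that the spin at `i` is up given the other spins. -/
def siteProb (w : (V → Bool) → ℝ) (i : V) (σ : V → Bool) : ℝ :=
  w (Function.update σ i true) / ∑ b, w (Function.update σ i b)

lemma siteProb_mem {w : (V → Bool) → ℝ} (hw : ∀ σ, 0 < w σ) (i : V) (σ : V → Bool) :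
    0 ≤ siteProb w i σ ∧ siteProb w i σ ≤ 1 := by
  refine ⟨div_nonneg (hw _).le (sum_bool_pos hw i σ).le, ?_⟩
  rw [siteProb, div_le_one (sum_bool_pos hw i σ), Fintype.sum_bool]
  linarith [hw (Function.update σ i false)]

lemma condMean_eq_siteProb {w : (V → Bool) → ℝ} (hw : ∀ σ, 0 < w σ) (f : (V → Bool) → ℝ)
    (i : V) (σ : V → Bool) :
    condMean w f i σ = siteProb w i σ * f (Function.update σ i true)
      + (1 - siteProb w i σ) * f (Function.update σ i false) := by
  have hD := (sum_bool_pos hw i σ).ne'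
  rw [condMean, siteProb, div_eq_iff hD]
  field_simp
  simp only [Fintype.sum_bool]
  ring

/-- Discrete derivative of `f` in the spin at `j`. -/
def spinDiff (f : (V → Bool) → ℝ) (j : V) (σ : V → Bool) : ℝ :=
  f (Function.update σ j true) - f (Function.update σ j false)

lemma spinDiff_condMean_self (w f : (V → Bool) → ℝ) (j : V) (σ : V → Bool) :
    spinDiff (condMean w f j) j σ = 0 := by
  simp [spinDiff, condMean_update]

lemma abs_spinDiff_condMean_le {w : (V → Bool) → ℝ} (hw : ∀ σ, 0 < w σ) {R M : ℝ} {i j : V}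
    (hij : i ≠ j) (hR : ∀ σ, |spinDiff (siteProb w i) j σ| ≤ R) {f : (V → Bool) → ℝ}
    (hM : ∀ k σ, |spinDiff f k σ| ≤ M) (σ : V → Bool) :
    |spinDiff (condMean w f i) j σ| ≤ M + R * M := by
  set p := siteProb w i (Function.update σ j true) with hp
  set q := siteProb w i (Function.update σ j false) with hq
  have hcomm : ∀ b c, Function.update (Function.update σ j b) i c
      = Function.update (Function.update σ i c) j b := fun b c =>
    Function.update_comm hij.symm b c σ
  have hsplit : spinDiff (condMean w f i) j σ
      = p * spinDiff f j (Function.update σ i true)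
        + (1 - p) * spinDiff f j (Function.update σ i false)
        + (p - q) * spinDiff f i (Function.update σ j false) := by
    simp only [spinDiff, condMean_eq_siteProb hw, ← hp, ← hq, hcomm]
    ring
  obtain ⟨hp0, hp1⟩ := siteProb_mem hw i (Function.update σ j true)
  rw [← hp] at hp0 hp1
  have h1 : |p * spinDiff f j (Function.update σ i true)| ≤ p * M := by
    rw [abs_mul, abs_of_nonneg hp0]; gcongr; exact hM _ _
  have h2 : |(1 - p) * spinDiff f j (Function.update σ i false)| ≤ (1 - p) * M := by
    rw [abs_mul, abs_of_nonneg (by linarith : 0 ≤ 1 - p)]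
    exact mul_le_mul_of_nonneg_left (hM _ _) (by linarith)
  have h3 : |(p - q) * spinDiff f i (Function.update σ j false)| ≤ R * M := by
    rw [abs_mul]
    exact mul_le_mul (hR σ) (hM _ _) (abs_nonneg _) ((abs_nonneg _).trans (hR σ))
  rw [hsplit]
  linarith [abs_add_three (p * spinDiff f j (Function.update σ i true))
    ((1 - p) * spinDiff f j (Function.update σ i false))
    ((p - q) * spinDiff f i (Function.update σ j false))]

/-- Eigenfunctions of the heat-bath generator below the Dobrushin gap are constant. -/
lemma spinDiff_eq_zero_of_eigen {w : (V → Bool) → ℝ} (hw : ∀ σ, 0 < w σ) {R : V → V → ℝ}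
    (hR0 : ∀ i j, 0 ≤ R i j) (hR : ∀ i j, i ≠ j → ∀ σ, |spinDiff (siteProb w i) j σ| ≤ R i j)
    {c : ℝ} (hc : ∀ j, ∑ i, R i j ≤ c) {lam : ℝ} (hlam : lam < 1 - c) {f : (V → Bool) → ℝ}
    (hf : ∀ σ, ∑ i, (f σ - condMean w f i σ) = lam * f σ) (j : V) (σ : V → Bool) :
    spinDiff f j σ = 0 := by
  have : Nonempty (V × (V → Bool)) := ⟨(j, σ)⟩
  obtain ⟨⟨k, ρ⟩, hmax⟩ := Finite.exists_max fun x : V × (V → Bool) => |spinDiff f x.1 x.2|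
  set M := |spinDiff f k ρ| with hMdef
  have hM : ∀ k σ, |spinDiff f k σ| ≤ M := fun k σ => hmax (k, σ)
  have hM0 : 0 ≤ M := abs_nonneg _
  obtain ⟨s, hs, hsM⟩ : ∃ s : ℝ, |s| = 1 ∧ s * spinDiff f k ρ = M := by
    rcases abs_cases (spinDiff f k ρ) with ⟨h, _⟩ | ⟨h, _⟩
    · exact ⟨1, by simp, by rw [hMdef, h, one_mul]⟩
    · exact ⟨-1, by simp, by rw [hMdef, h, neg_one_mul]⟩
  have hterm : ∀ i, (if i = k then M else 0) - R i k * M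
      ≤ s * (spinDiff f k ρ - spinDiff (condMean w f i) k ρ) := by
    intro i
    have hRM := mul_nonneg (hR0 i k) hM0
    rw [mul_sub, hsM]
    split_ifs with hik
    · subst hik; rw [spinDiff_condMean_self]; linarith
    · have h1 := abs_spinDiff_condMean_le hw hik (hR i k hik) hM ρ
      have h2 : s * spinDiff (condMean w f i) k ρ ≤ |spinDiff (condMean w f i) k ρ| :=
        (le_abs_self _).trans (by rw [abs_mul, hs, one_mul])
      linarith
  have hsum := Finset.sum_le_sum fun i (_ : i ∈ Finset.univ) => hterm i
  rw [Finset.sum_sub_distrib, Finset.sum_ite_eq' Finset.univ k, if_pos (Finset.mem_univ k),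
    ← Finset.sum_mul, ← Finset.mul_sum] at hsum
  have heig : ∑ i, (spinDiff f k ρ - spinDiff (condMean w f i) k ρ) = lam * spinDiff f k ρ := by
    have h1 := hf (Function.update ρ k true)
    have h2 := hf (Function.update ρ k false)
    simp only [spinDiff]
    rw [mul_sub, ← h1, ← h2, ← Finset.sum_sub_distrib]
    exact Finset.sum_congr rfl fun i _ => by ring
  rw [heig, mul_left_comm, hsM] at hsum
  have hMz : M = 0 := by nlinarith [mul_le_mul_of_nonneg_right (hc k) hM0]
  exact abs_eq_zero.1 (le_antisymm ((hM j σ).trans hMz.le) (abs_nonneg _))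

/-- Approximate tensorization of variance under a Dobrushin condition, for an unnormalized
weight. -/
lemma variance_tensorization {w : (V → Bool) → ℝ} (hw : ∀ σ, 0 < w σ) {R : V → V → ℝ}
    (hR0 : ∀ i j, 0 ≤ R i j) (hR : ∀ i j, i ≠ j → ∀ σ, |spinDiff (siteProb w i) j σ| ≤ R i j)
    {c : ℝ} (hc : ∀ j, ∑ i, R i j ≤ c) (f : (V → Bool) → ℝ) :
    (1 - c) * ∑ σ, w σ * (f σ - (∑ τ, w τ * f τ) / ∑ τ, w τ) ^ 2
      ≤ ∑ i, siteVarTerm w f i := by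
  have hZ : 0 < ∑ τ, w τ := Finset.sum_pos (fun τ _ => hw τ) Finset.univ_nonempty
  let m : ((V → Bool) → ℝ) →ₗ[ℝ] ℝ :=
    (∑ τ, w τ)⁻¹ • ∑ τ, w τ • LinearMap.proj τ
  have hm : ∀ g, m g = (∑ τ, w τ * g τ) / ∑ τ, w τ := fun g => by
    simp [m, div_eq_inv_mul]
  let T : ((V → Bool) → ℝ) →ₗ[ℝ] ((V → Bool) → ℝ) :=
    ∑ i, (LinearMap.id - condMeanLin w i)
      - (1 - c) • (LinearMap.id - LinearMap.pi fun _ => m)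
  have hT : ∀ g σ, T g σ = ∑ i, (g σ - condMean w g i σ) - (1 - c) * (g σ - m g) := fun g σ => by
    simp [T, condMeanLin]
  have hmean : ∀ g, ∑ σ, w σ * m g = ∑ σ, w σ * g σ := fun g => by
    rw [← Finset.sum_mul, hm, mul_div_cancel₀ _ hZ.ne']
  have hform : ∀ f g, ∑ σ, w σ * (f σ * T g σ)
      = ∑ i, (∑ σ, w σ * (f σ * g σ) - ∑ σ, w σ * (f σ * condMean w g i σ))
        - (1 - c) * (∑ σ, w σ * (f σ * g σ) - (∑ τ, w τ) * (m f * m g)) := fun f g => by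
    have h1 : (∑ τ, w τ) * (m f * m g) = ∑ σ, w σ * (f σ * m g) := by
      simp only [← mul_assoc]
      rw [← Finset.sum_mul, ← hmean f, ← Finset.sum_mul]
    rw [h1]
    simp only [← Finset.sum_sub_distrib, Finset.mul_sum]
    rw [Finset.sum_comm, ← Finset.sum_sub_distrib]
    refine Finset.sum_congr rfl fun σ _ => ?_
    rw [hT, mul_sub, mul_sub, Finset.mul_sum, Finset.mul_sum]
    congr 1
    · exact Finset.sum_congr rfl fun i _ => by ring
    · ring
  have hsym : ∀ f g, ∑ σ, w σ * (f σ * T g σ) = ∑ σ, w σ * (T f σ * g σ) := fun f g => by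
    have h1 : ∑ σ, w σ * (T f σ * g σ) = ∑ σ, w σ * (g σ * T f σ) :=
      Finset.sum_congr rfl fun σ _ => by ring
    rw [h1, hform, hform]
    have h2 : ∑ σ, w σ * (g σ * f σ) = ∑ σ, w σ * (f σ * g σ) :=
      Finset.sum_congr rfl fun σ _ => by ring
    have h3 : ∀ i, ∑ σ, w σ * (g σ * condMean w f i σ)
        = ∑ σ, w σ * (f σ * condMean w g i σ) := fun i => by
      rw [sum_condMean_mul_comm hw i f g]
      exact Finset.sum_congr rfl fun σ _ => by ring
    simp only [h2, h3, mul_comm (m g)]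
  have heig : ∀ κ : ℝ, κ < 0 → ∀ f, T f = κ • f → f = 0 := by
    intro κ hκ g hg
    have hmg : m g = 0 := by
      have h1 := hform (fun _ => 1) g
      have h2 : ∀ i, ∑ σ, w σ * condMean w g i σ = ∑ σ, w σ * g σ := fun i => by
        simpa using sum_mul_condMean hw i (c := fun _ => 1) (fun _ _ => rfl) g
      have h3 : m (fun _ => 1) = 1 := by rw [hm]; simp [hZ.ne']
      have h4 : (∑ τ, w τ) * m g = ∑ σ, w σ * g σ := by rw [Finset.sum_mul, hmean]
      simp only [h2, hg, h3, one_mul, h4, sub_self, Finset.sum_const_zero, mul_zero,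
        Pi.smul_apply, smul_eq_mul] at h1
      simp only [mul_left_comm _ κ] at h1
      rw [← Finset.mul_sum] at h1
      rw [hm, (mul_eq_zero.1 h1).resolve_left hκ.ne, zero_div]
    have hgen : ∀ σ, ∑ i, (g σ - condMean w g i σ) = (1 - c + κ) * g σ := fun σ => by
      have h1 := congrFun hg σ
      rw [hT, hmg] at h1
      simp only [Pi.smul_apply, smul_eq_mul] at h1
      linarith
    have hdiff := spinDiff_eq_zero_of_eigen hw hR0 hR hc (by linarith) hgen
    have hconst : ∀ σ τ, g σ = g τ := eq_of_forall_update_eq fun j σ b => by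
      have h1 : g (Function.update σ j true) = g (Function.update σ j false) :=
        sub_eq_zero.1 (hdiff j σ)
      have h2 := Function.update_eq_self j σ
      cases hj : σ j <;> rw [hj] at h2 <;> cases b
      · rw [h2]
      · rw [h1, h2]
      · rw [← h1, h2]
      · rw [h2]
    ext σ
    have h1 : m g = g σ := by
      rw [hm, Finset.sum_congr rfl fun τ _ => by rw [hconst τ σ], ← Finset.sum_mul,
        mul_div_cancel_left₀ _ hZ.ne']
    rw [← h1, hmg]; rfl
  have hnn := weighted_form_nonneg hw T hsym heig f
  rw [hform] at hnn
  have hvar : ∑ σ, w σ * (f σ - (∑ τ, w τ * f τ) / ∑ τ, w τ) ^ 2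
      = ∑ σ, w σ * (f σ * f σ) - (∑ τ, w τ) * (m f * m f) := by
    rw [← hm]
    have h1 : ∀ σ, w σ * (f σ - m f) ^ 2
        = w σ * (f σ * f σ) - 2 * m f * (w σ * f σ) + m f * (w σ * m f) := fun σ => by ring
    simp only [h1, Finset.sum_add_distrib, Finset.sum_sub_distrib, ← Finset.mul_sum, hmean]
    rw [← hmean f, ← Finset.sum_mul]; ring
  have hsite : ∀ i, siteVarTerm w f i
      = ∑ σ, w σ * (f σ * f σ) - ∑ σ, w σ * (f σ * condMean w f i σ) := fun i => by
    rw [siteVarTerm_eq hw, ← Finset.sum_sub_distrib]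
    exact Finset.sum_congr rfl fun σ _ => by ring
  rw [hvar, Finset.sum_congr rfl fun i _ => hsite i]
  linarith

/-! ### A maximum principle for the heat operator `∂ₜ - ½ ∑ₖ ∂²_{aₖ}` -/

open Set Filter Topology

/-- At `(t, h)` the function `v` is differentiable in time, twice differentiable along each `a k`,
and the heat operator takes the value `ℓ`. -/
def HasHeatAt {E K : Type*} [AddCommGroup E] [Module ℝ E] [Fintype K] (a : K → E)
    (v : ℝ → E → ℝ) (ℓ t : ℝ) (h : E) : Prop :=
  ∃ (dt : ℝ) (g : K → ℝ → ℝ) (d : K → ℝ), HasDerivAt (fun s => v s h) dt t ∧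
    (∀ k x, HasDerivAt (fun y : ℝ => v t (h + y • a k)) (g k x) x) ∧
    (∀ k, HasDerivAt (g k) (d k) 0) ∧ ℓ = dt - 1 / 2 * ∑ k, d k

namespace HasHeatAt

variable {E K : Type*} [AddCommGroup E] [Module ℝ E] [Fintype K] {a : K → E}
  {u v : ℝ → E → ℝ} {ℓ m t : ℝ} {h : E}

lemma sub (hu : HasHeatAt a u ℓ t h) (hv : HasHeatAt a v m t h) :
    HasHeatAt a (fun s k => u s k - v s k) (ℓ - m) t h := by
  obtain ⟨dt, g, d, h1, h2, h3, rfl⟩ := hu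
  obtain ⟨dt', g', d', h1', h2', h3', rfl⟩ := hv
  refine ⟨dt - dt', fun k x => g k x - g' k x, fun k => d k - d' k, h1.sub h1',
    fun k x => (h2 k x).sub (h2' k x), fun k => (h3 k).sub (h3' k), ?_⟩
  rw [Finset.sum_sub_distrib]; ring

lemma sum {ι : Type*} [Fintype ι] {v : ι → ℝ → E → ℝ} {ℓ : ι → ℝ}
    (hv : ∀ i, HasHeatAt a (v i) (ℓ i) t h) :
    HasHeatAt a (fun s k => ∑ i, v i s k) (∑ i, ℓ i) t h := by
  choose dt g d h1 h2 h3 h4 using hv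
  refine ⟨∑ i, dt i, fun k x => ∑ i, g i k x, fun k => ∑ i, d i k,
    HasDerivAt.fun_sum fun i _ => h1 i, fun k x => HasDerivAt.fun_sum fun i _ => h2 i k x,
    fun k => HasDerivAt.fun_sum fun i _ => h3 i k, ?_⟩
  rw [Finset.sum_congr rfl fun i _ => h4 i, Finset.sum_sub_distrib, ← Finset.mul_sum,
    Finset.sum_comm]

/-- Multiplication by a function of time. -/
lemma time_mul {φ : ℝ → ℝ} {φ' : ℝ} (hφ : HasDerivAt φ φ' t) (hv : HasHeatAt a v ℓ t h) :
    HasHeatAt a (fun s k => φ s * v s k) (φ' * v t h + φ t * ℓ) t h := by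
  obtain ⟨dt, g, d, h1, h2, h3, rfl⟩ := hv
  refine ⟨_, fun k x => φ t * g k x, fun k => φ t * d k, hφ.mul h1,
    fun k x => (h2 k x).const_mul _, fun k => (h3 k).const_mul _, ?_⟩
  rw [← Finset.mul_sum]; ring

lemma const_mul (c : ℝ) (hv : HasHeatAt a v ℓ t h) :
    HasHeatAt a (fun s k => c * v s k) (c * ℓ) t h := by
  simpa using hv.time_mul (hasDerivAt_const t c)

end HasHeatAt

lemma HasDerivAt.nonneg_of_isMaxOn_Icc {f : ℝ → ℝ} {f' a b : ℝ} (hf : HasDerivAt f f' b)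
    (hab : a < b) (hmax : IsMaxOn f (Icc a b) b) : 0 ≤ f' := by
  have h1 := (hasDerivWithinAt_iff_tendsto_slope' (s := Iio b) (by simp)).1 hf.hasDerivWithinAt
  refine ge_of_tendsto h1 ?_
  filter_upwards [Ioo_mem_nhdsLT hab] with x hx
  have h2 : f x ≤ f b := hmax ⟨hx.1.le, hx.2.le⟩
  rw [slope_def_field]
  exact div_nonneg_of_nonpos (by linarith) (by linarith [hx.2])

lemma nonpos_of_second_deriv_of_forall_le {f g : ℝ → ℝ} {d : ℝ}
    (hf : ∀ x, HasDerivAt f (g x) x) (hg : HasDerivAt g d 0) (hmax : ∀ x, f x ≤ f 0) : d ≤ 0 := by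
  by_contra! hd
  have hderiv : deriv f = g := funext fun x => (hf x).deriv
  have hlmax : IsLocalMax f 0 := Eventually.of_forall hmax
  have hg0 : g 0 = 0 := hlmax.hasDerivAt_eq_zero (hf 0)
  have hlmin : IsLocalMin f 0 := isLocalMin_of_deriv_deriv_pos
    (by rw [hderiv, hg.deriv]; exact hd) (by rw [hderiv, hg0]) (hf 0).continuousAt
  have hconst : f =ᶠ[𝓝 0] fun _ => f 0 := by
    filter_upwards [hlmin] with x hx using le_antisymm (hmax x) hx
  have hgz : g =ᶠ[𝓝 0] fun _ => 0 := by
    have := hconst.deriv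
    rw [hderiv] at this
    simpa using this
  exact hd.ne' (hg.unique ((hasDerivAt_const 0 (0 : ℝ)).congr_of_eventuallyEq hgz))

/-- Maximum principle: a function with negative heat operator which is nonpositive initially and
far away is nonpositive. -/
lemma heat_max_principle {K : Type*} [Fintype K] {a : K → V → ℝ} {v : ℝ → (V → ℝ) → ℝ}
    (hcont : Continuous fun p : ℝ × (V → ℝ) => v p.1 p.2) (hinit : ∀ h, v 0 h ≤ 0)
    (hheat : ∀ t ∈ Ioc (0 : ℝ) 1, ∀ h, ∃ ℓ < 0, HasHeatAt a v ℓ t h) {R : ℝ}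
    (hfar : ∀ t ∈ Icc (0 : ℝ) 1, ∀ h, R < ‖h‖ → v t h ≤ 0) {t : ℝ} (ht : t ∈ Icc (0 : ℝ) 1)
    (h : V → ℝ) : v t h ≤ 0 := by
  have hcpt : IsCompact (Icc (0 : ℝ) 1 ×ˢ Metric.closedBall (0 : V → ℝ) (max R 0)) :=
    isCompact_Icc.prod (isCompact_closedBall _ _)
  obtain ⟨⟨t₁, h₁⟩, hmem, hmax⟩ := hcpt.exists_isMaxOn
    ⟨(0, 0), ⟨by simp, by simp⟩⟩ hcont.continuousOn
  have ht₁ : t₁ ∈ Icc (0 : ℝ) 1 := hmem.1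
  have hin : ∀ s ∈ Icc (0 : ℝ) 1, ∀ k, ¬ R < ‖k‖ → v s k ≤ v t₁ h₁ := fun s hs k hk =>
    hmax (show (s, k) ∈ Icc (0 : ℝ) 1 ×ˢ Metric.closedBall (0 : V → ℝ) (max R 0) from
      ⟨hs, by simpa using Or.inl (not_lt.1 hk)⟩)
  rcases le_or_gt (v t₁ h₁) 0 with hneg | hpos
  · by_cases hk : R < ‖h‖
    · exact hfar t ht h hk
    · exact (hin t ht h hk).trans hneg
  exfalso
  have hglob : ∀ s ∈ Icc (0 : ℝ) 1, ∀ k, v s k ≤ v t₁ h₁ := fun s hs k => by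
    by_cases hk : R < ‖k‖
    · exact (hfar s hs k hk).trans hpos.le
    · exact hin s hs k hk
  have ht₁pos : 0 < t₁ := by
    refine lt_of_le_of_ne ht₁.1 fun h0 => ?_
    rw [← h0] at hpos
    exact absurd (hinit h₁) (not_le.2 hpos)
  obtain ⟨ℓ, hℓ, dt, g, d, hd1, hd2, hd3, rfl⟩ := hheat t₁ ⟨ht₁pos, ht₁.2⟩ h₁
  have hdt : 0 ≤ dt := hd1.nonneg_of_isMaxOn_Icc ht₁pos fun s hs =>
    hglob s ⟨hs.1, hs.2.trans ht₁.2⟩ h₁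
  have hd : ∀ k, d k ≤ 0 := fun k =>
    nonpos_of_second_deriv_of_forall_le (hd2 k) (hd3 k) fun x => by
      simpa using hglob t₁ ht₁ (h₁ + x • a k)
  linarith [Finset.sum_nonpos fun k (_ : k ∈ Finset.univ) => hd k]

/-! ### The entropy functional along Gaussian tilts -/

/-- Unnormalized entropy of `F` under the weight `w`. -/
def wEnt {ι : Type*} [Fintype ι] (w F : ι → ℝ) : ℝ :=
  ∑ j, w j * (F j * Real.log (F j))
    - (∑ j, w j * F j) * (Real.log (∑ j, w j * F j) - Real.log (∑ j, w j))

/-- Derivative of `wEnt` with respect to the weight at `j`. -/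
def wEntGrad {ι : Type*} [Fintype ι] (w F : ι → ℝ) (j : ι) : ℝ :=
  F j * Real.log (F j)
    - F j * (Real.log (∑ j, w j * F j) - Real.log (∑ j, w j) + 1)
    + (∑ j, w j * F j) / ∑ j, w j

/-- The Gaussian tilt `exp (t / 2 * ∑ₖ ⟨aₖ, y⟩² + ⟨h, y⟩)`. -/
def gaussTilt {K : Type*} [Fintype K] (a : K → V → ℝ) (y : V → ℝ) (t : ℝ) (h : V → ℝ) : ℝ :=
  Real.exp (t / 2 * ∑ k, (a k ⬝ᵥ y) ^ 2 + h ⬝ᵥ y)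

section WEnt

variable {ι : Type*} [Fintype ι] [Nonempty ι]

lemma hasDerivAt_wEnt {w : ℝ → ι → ℝ} {w' F : ι → ℝ} {x : ℝ} (hw : ∀ j, 0 < w x j)
    (hF : ∀ j, 0 < F j) (hd : ∀ j, HasDerivAt (fun y => w y j) (w' j) x) :
    HasDerivAt (fun y => wEnt (w y) F) (∑ j, w' j * wEntGrad (w x) F j) x := by
  have hX : 0 < ∑ j, w x j * F j :=
    Finset.sum_pos (fun j _ => mul_pos (hw j) (hF j)) Finset.univ_nonempty
  have hY : 0 < ∑ j, w x j := Finset.sum_pos (fun j _ => hw j) Finset.univ_nonempty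
  have dP : HasDerivAt (fun y => ∑ j, w y j * (F j * Real.log (F j)))
      (∑ j, w' j * (F j * Real.log (F j))) x :=
    HasDerivAt.fun_sum fun j _ => (hd j).mul_const _
  have dX : HasDerivAt (fun y => ∑ j, w y j * F j) (∑ j, w' j * F j) x :=
    HasDerivAt.fun_sum fun j _ => (hd j).mul_const _
  have dY : HasDerivAt (fun y => ∑ j, w y j) (∑ j, w' j) x :=
    HasDerivAt.fun_sum fun j _ => hd j
  refine (dP.sub (dX.mul ((dX.log hX.ne').sub (dY.log hY.ne')))).congr_deriv ?_
  simp only [wEntGrad, Pi.sub_apply]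
  set X := ∑ j, w x j * F j
  set Y := ∑ j, w x j
  have h1 : ∀ j, w' j * (F j * Real.log (F j) - F j * (Real.log X - Real.log Y + 1) + X / Y)
      = w' j * (F j * Real.log (F j)) - w' j * F j * (Real.log X - Real.log Y + 1)
        + w' j * (X / Y) := fun j => by ring
  simp only [h1, Finset.sum_add_distrib, Finset.sum_sub_distrib, ← Finset.sum_mul]
  field_simp
  ring

lemma hasDerivAt_wEntGrad {w : ℝ → ι → ℝ} {w' F : ι → ℝ} {x : ℝ} (hw : ∀ j, 0 < w x j)
    (hF : ∀ j, 0 < F j) (hd : ∀ j, HasDerivAt (fun y => w y j) (w' j) x) (j : ι) :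
    HasDerivAt (fun y => wEntGrad (w y) F j)
      ((∑ j, w' j * F j) / (∑ j, w x j)
        - (∑ j, w x j * F j) * (∑ j, w' j) / (∑ j, w x j) ^ 2
        - F j * ((∑ j, w' j * F j) / (∑ j, w x j * F j) - (∑ j, w' j) / ∑ j, w x j)) x := by
  have hX : 0 < ∑ j, w x j * F j :=
    Finset.sum_pos (fun j _ => mul_pos (hw j) (hF j)) Finset.univ_nonempty
  have hY : 0 < ∑ j, w x j := Finset.sum_pos (fun j _ => hw j) Finset.univ_nonempty
  have dX : HasDerivAt (fun y => ∑ j, w y j * F j) (∑ j, w' j * F j) x :=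
    HasDerivAt.fun_sum fun j _ => (hd j).mul_const _
  have dY : HasDerivAt (fun y => ∑ j, w y j) (∑ j, w' j) x :=
    HasDerivAt.fun_sum fun j _ => hd j
  have h1 := (((hasDerivAt_const x (F j * Real.log (F j))).sub
    ((((dX.log hX.ne').sub (dY.log hY.ne')).add_const 1).const_mul (F j))).add
    (dX.div dY hY.ne'))
  refine h1.congr_deriv ?_
  field_simp
  ring

variable {K : Type*} [Fintype K] (a : K → V → ℝ)

lemma gaussTilt_pos (y : V → ℝ) (t : ℝ) (h : V → ℝ) : 0 < gaussTilt a y t h := Real.exp_pos _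

lemma hasDerivAt_gaussTilt_time (y : V → ℝ) (t : ℝ) (h : V → ℝ) :
    HasDerivAt (fun s => gaussTilt a y s h)
      (gaussTilt a y t h * (1 / 2 * ∑ k, (a k ⬝ᵥ y) ^ 2)) t := by
  have h1 : HasDerivAt (fun s : ℝ => s / 2 * ∑ k, (a k ⬝ᵥ y) ^ 2 + h ⬝ᵥ y)
      (1 / 2 * ∑ k, (a k ⬝ᵥ y) ^ 2) t :=
    (((hasDerivAt_id t).div_const 2).mul_const _).add_const _
  exact h1.exp

lemma hasDerivAt_gaussTilt_space (y : V → ℝ) (t : ℝ) (h b : V → ℝ) (x : ℝ) :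
    HasDerivAt (fun z : ℝ => gaussTilt a y t (h + z • b))
      (gaussTilt a y t (h + x • b) * (b ⬝ᵥ y)) x := by
  have h1 : HasDerivAt (fun z : ℝ => t / 2 * ∑ k, (a k ⬝ᵥ y) ^ 2 + (h + z • b) ⬝ᵥ y)
      (b ⬝ᵥ y) x := by
    simp only [add_dotProduct, smul_dotProduct, smul_eq_mul]
    simpa using (((hasDerivAt_id x).mul_const (b ⬝ᵥ y)).const_add (h ⬝ᵥ y)).const_add
      (t / 2 * ∑ k, (a k ⬝ᵥ y) ^ 2)
  exact h1.exp

/-- The heat operator applied to the entropy is half the squared shift of the barycenter. -/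
lemma hasHeatAt_wEnt (y : ι → V → ℝ) {F : ι → ℝ} (hF : ∀ j, 0 < F j) (t : ℝ) (h : V → ℝ) :
    HasHeatAt a (fun s k => wEnt (fun j => gaussTilt a (y j) s k) F)
      (1 / 2 * (∑ j, gaussTilt a (y j) t h * F j) * ∑ k,
        ((∑ j, gaussTilt a (y j) t h * (a k ⬝ᵥ y j) * F j) / (∑ j, gaussTilt a (y j) t h * F j)
          - (∑ j, gaussTilt a (y j) t h * (a k ⬝ᵥ y j)) / ∑ j, gaussTilt a (y j) t h) ^ 2)
      t h := by
  have hpos : ∀ k j, 0 < gaussTilt a (y j) t k := fun k j => gaussTilt_pos a _ _ _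
  refine ⟨_, fun k x => ∑ j, gaussTilt a (y j) t (h + x • a k) * (a k ⬝ᵥ y j) *
      wEntGrad (fun j => gaussTilt a (y j) t (h + x • a k)) F j, _,
    hasDerivAt_wEnt (hpos h) hF fun j => hasDerivAt_gaussTilt_time a (y j) t h,
    fun k x => hasDerivAt_wEnt (w := fun x j => gaussTilt a (y j) t (h + x • a k))
      (hpos _) hF fun j => hasDerivAt_gaussTilt_space a (y j) t h (a k) x,
    fun k => HasDerivAt.fun_sum fun j _ =>
      ((hasDerivAt_gaussTilt_space a (y j) t h (a k) 0).mul_const (a k ⬝ᵥ y j)).mul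
        (hasDerivAt_wEntGrad (w := fun x j => gaussTilt a (y j) t (h + x • a k))
          (hpos _) hF (fun j => hasDerivAt_gaussTilt_space a (y j) t h (a k) 0) j), ?_⟩
  simp only [zero_smul, add_zero]
  set w : ι → ℝ := fun j => gaussTilt a (y j) t h with hw
  have hX : 0 < ∑ j, w j * F j :=
    Finset.sum_pos (fun j _ => mul_pos (hpos h j) (hF j)) Finset.univ_nonempty
  have hY : 0 < ∑ j, w j := Finset.sum_pos (fun j _ => hpos h j) Finset.univ_nonempty
  have hwj : ∀ j, gaussTilt a (y j) t h = w j := fun j => rfl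
  simp only [hwj]
  set X := ∑ j, w j * F j
  set Y := ∑ j, w j
  have hsplit : ∀ k, ∑ j, (w j * (a k ⬝ᵥ y j) * (a k ⬝ᵥ y j) * wEntGrad w F j
        + w j * (a k ⬝ᵥ y j) * ((∑ i, w i * (a k ⬝ᵥ y i) * F i) / Y
          - X * (∑ i, w i * (a k ⬝ᵥ y i)) / Y ^ 2
          - F j * ((∑ i, w i * (a k ⬝ᵥ y i) * F i) / X - (∑ i, w i * (a k ⬝ᵥ y i)) / Y)))
      = ∑ j, w j * (a k ⬝ᵥ y j) ^ 2 * wEntGrad w F j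
        - X * ((∑ j, w j * (a k ⬝ᵥ y j) * F j) / X - (∑ j, w j * (a k ⬝ᵥ y j)) / Y) ^ 2 := by
    intro k
    set X' := ∑ i, w i * (a k ⬝ᵥ y i) * F i with hX'
    set Y' := ∑ i, w i * (a k ⬝ᵥ y i) with hY'
    have h1 : ∀ j, w j * (a k ⬝ᵥ y j) * (a k ⬝ᵥ y j) * wEntGrad w F j
        + w j * (a k ⬝ᵥ y j) * (X' / Y - X * Y' / Y ^ 2 - F j * (X' / X - Y' / Y))
        = w j * (a k ⬝ᵥ y j) ^ 2 * wEntGrad w F j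
          + w j * (a k ⬝ᵥ y j) * (X' / Y - X * Y' / Y ^ 2)
          - w j * (a k ⬝ᵥ y j) * F j * (X' / X - Y' / Y) := fun j => by ring
    simp only [h1, Finset.sum_add_distrib, Finset.sum_sub_distrib, ← Finset.sum_mul, ← hX', ← hY']
    field_simp
    ring
  have htime : ∑ j, w j * (1 / 2 * ∑ k, (a k ⬝ᵥ y j) ^ 2) * wEntGrad w F j
      = 1 / 2 * ∑ k, ∑ j, w j * (a k ⬝ᵥ y j) ^ 2 * wEntGrad w F j := by
    rw [Finset.sum_comm, Finset.mul_sum]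
    refine Finset.sum_congr rfl fun j _ => ?_
    rw [← Finset.sum_mul, ← Finset.mul_sum]; ring
  rw [Finset.sum_congr rfl fun k _ => hsplit k, htime, Finset.sum_sub_distrib, ← Finset.mul_sum]
  ring

end WEnt

/-! ### Entropy inequalities -/

section Entropy

variable {ι : Type*} [Fintype ι] [Nonempty ι]

lemma mul_log_sub_log_ge {x y : ℝ} (hx : 0 < x) (hy : 0 < y) :
    x - y ≤ x * (Real.log x - Real.log y) := by
  have h1 := Real.log_le_sub_one_of_pos (div_pos hy hx)
  rw [Real.log_div hy.ne' hx.ne'] at h1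
  have h2 := mul_le_mul_of_nonneg_left h1 hx.le
  rw [mul_sub, mul_sub, mul_div_cancel₀ _ hx.ne'] at h2
  linarith

lemma wEnt_nonneg {w F : ι → ℝ} (hw : ∀ j, 0 < w j) (hF : ∀ j, 0 < F j) : 0 ≤ wEnt w F := by
  have hX : 0 < ∑ j, w j * F j :=
    Finset.sum_pos (fun j _ => mul_pos (hw j) (hF j)) Finset.univ_nonempty
  have hY : 0 < ∑ j, w j := Finset.sum_pos (fun j _ => hw j) Finset.univ_nonempty
  rw [wEnt, ← Real.log_div hX.ne' hY.ne']
  set c := (∑ j, w j * F j) / ∑ j, w j with hc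
  have hcpos : 0 < c := div_pos hX hY
  have h1 : ∑ j, w j * (F j - c) ≤ ∑ j, w j * (F j * (Real.log (F j) - Real.log c)) :=
    Finset.sum_le_sum fun j _ =>
      mul_le_mul_of_nonneg_left (mul_log_sub_log_ge (hF j) hcpos) (hw j).le
  have h2 : ∑ j, w j * (F j - c) = 0 := by
    simp only [mul_sub, Finset.sum_sub_distrib, ← Finset.sum_mul]
    rw [hc, mul_div_cancel₀ _ hY.ne', sub_self]
  have h3 : ∑ j, w j * (F j * (Real.log (F j) - Real.log c))
      = ∑ j, w j * (F j * Real.log (F j)) - (∑ j, w j * F j) * Real.log c := by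
    rw [Finset.sum_mul, ← Finset.sum_sub_distrib]
    exact Finset.sum_congr rfl fun j _ => by ring
  linarith

lemma wEnt_le {w F : ι → ℝ} (hw : ∀ j, 0 < w j) (hF : ∀ j, 0 < F j) :
    wEnt w F ≤ ∑ j, w j * (F j * Real.log (F j) - F j + 1) := by
  have hX : 0 < ∑ j, w j * F j :=
    Finset.sum_pos (fun j _ => mul_pos (hw j) (hF j)) Finset.univ_nonempty
  have hY : 0 < ∑ j, w j := Finset.sum_pos (fun j _ => hw j) Finset.univ_nonempty
  have h1 := mul_log_sub_log_ge hX hY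
  have h2 : ∑ j, w j * (F j * Real.log (F j) - F j + 1)
      = ∑ j, w j * (F j * Real.log (F j)) - ∑ j, w j * F j + ∑ j, w j := by
    rw [← Finset.sum_sub_distrib, ← Finset.sum_add_distrib]
    exact Finset.sum_congr rfl fun j _ => by ring
  rw [wEnt, h2]
  linarith

/-- The Donsker–Varadhan inequality. -/
lemma sum_mul_le_wEnt_add {w F : ι → ℝ} (hw : ∀ j, 0 < w j) (hF : ∀ j, 0 < F j) (g : ι → ℝ) :
    ∑ j, w j * F j * g j ≤ wEnt w F
      + (∑ j, w j * F j) * (Real.log (∑ j, w j * Real.exp (g j)) - Real.log (∑ j, w j)) := by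
  have h := wEnt_nonneg (w := fun j => w j * Real.exp (g j)) (F := fun j => F j * Real.exp (-g j))
    (fun j => mul_pos (hw j) (Real.exp_pos _)) (fun j => mul_pos (hF j) (Real.exp_pos _))
  have h1 : ∀ j, w j * Real.exp (g j) * (F j * Real.exp (-g j)) = w j * F j := fun j => by
    rw [Real.exp_neg]; field_simp
  have h2 : ∀ j, w j * Real.exp (g j) * (F j * Real.exp (-g j)
      * Real.log (F j * Real.exp (-g j))) = w j * (F j * Real.log (F j)) - w j * F j * g j :=
    fun j => by
      rw [← mul_assoc, h1, Real.log_mul (hF j).ne' (Real.exp_pos _).ne', Real.log_exp]; ring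
  simp only [wEnt, h1, h2, Finset.sum_sub_distrib] at h ⊢
  linarith

/-- A variance bound along exponential tilts gives a Gaussian bound on the moment generating
function. -/
lemma log_sum_exp_sub_le {w r : ι → ℝ} (hw : ∀ j, 0 < w j) {c : ℝ}
    (hvar : ∀ x : ℝ, ∑ j, w j * Real.exp (x * r j) * (r j - (∑ j, w j * Real.exp (x * r j) * r j)
      / ∑ j, w j * Real.exp (x * r j)) ^ 2 ≤ c * ∑ j, w j * Real.exp (x * r j)) :
    Real.log (∑ j, w j * Real.exp (r j)) - Real.log (∑ j, w j)
      ≤ (∑ j, w j * r j) / (∑ j, w j) + c / 2 := by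
  set Z : ℝ → ℝ := fun x => ∑ j, w j * Real.exp (x * r j) with hZ
  set Z₁ : ℝ → ℝ := fun x => ∑ j, w j * Real.exp (x * r j) * r j with hZ₁
  set Z₂ : ℝ → ℝ := fun x => ∑ j, w j * Real.exp (x * r j) * r j * r j with hZ₂
  have hpos : ∀ x, 0 < Z x := fun x =>
    Finset.sum_pos (fun j _ => mul_pos (hw j) (Real.exp_pos _)) Finset.univ_nonempty
  have hexp : ∀ j x, HasDerivAt (fun x => w j * Real.exp (x * r j))
      (w j * Real.exp (x * r j) * r j) x := fun j x => by
    have h1 := (((hasDerivAt_id x).mul_const (r j)).exp).const_mul (w j)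
    simpa [mul_assoc] using h1
  have hdZ : ∀ x, HasDerivAt Z (Z₁ x) x := fun x => HasDerivAt.fun_sum fun j _ => hexp j x
  have hdZ₁ : ∀ x, HasDerivAt Z₁ (Z₂ x) x := fun x =>
    HasDerivAt.fun_sum fun j _ => (hexp j x).mul_const _
  have hvar' : ∀ x, (Z₂ x * Z x - Z₁ x * Z₁ x) / Z x ^ 2 ≤ c := fun x => by
    have h1 := hvar x
    have h2 : ∑ j, w j * Real.exp (x * r j) * (r j - Z₁ x / Z x) ^ 2
        = Z₂ x - 2 * (Z₁ x / Z x) * Z₁ x + Z x * (Z₁ x / Z x) ^ 2 := by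
      simp only [hZ₂]
      rw [hZ₁, hZ]
      simp only [Finset.mul_sum, Finset.sum_mul, ← Finset.sum_sub_distrib,
        ← Finset.sum_add_distrib]
      exact Finset.sum_congr rfl fun j _ => by ring
    have h3 := (h2.symm.trans_le h1)
    rw [div_le_iff₀ (pow_pos (hpos x) 2)]
    have h4 : Z₂ x - 2 * (Z₁ x / Z x) * Z₁ x + Z x * (Z₁ x / Z x) ^ 2
        = (Z₂ x * Z x - Z₁ x * Z₁ x) / Z x := by
      have := (hpos x).ne'; field_simp; ring
    rw [h4, div_le_iff₀ (hpos x)] at h3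
    linarith
  have hanti : Antitone fun x => Z₁ x / Z x - c * x := by
    refine antitone_of_hasDerivAt_nonpos (f' := fun x =>
      (Z₂ x * Z x - Z₁ x * Z₁ x) / Z x ^ 2 - c) (fun x => ?_) fun x => ?_
    · exact (((hdZ₁ x).div (hdZ x) (hpos x).ne').sub
        ((hasDerivAt_id x).const_mul c)).congr_deriv (by rw [mul_one])
    · simpa using hvar' x
  set m := Z₁ 0 / Z 0 with hm
  have hd : ∀ x, HasDerivAt (fun x => Real.log (Z x) - m * x - c / 2 * x ^ 2)
      (Z₁ x / Z x - m - c * x) x := fun x => by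
    refine ((((hdZ x).log (hpos x).ne').sub ((hasDerivAt_id x).const_mul m)).sub
      (((hasDerivAt_id x).pow 2).const_mul (c / 2))).congr_deriv ?_
    simp only [id]; ring
  have hanti' : AntitoneOn (fun x => Real.log (Z x) - m * x - c / 2 * x ^ 2) (Ici 0) := by
    refine antitoneOn_of_deriv_nonpos (convex_Ici 0)
      (fun x _ => (hd x).continuousAt.continuousWithinAt)
      (fun x _ => (hd x).differentiableAt.differentiableWithinAt) fun x hx => ?_
    rw [interior_Ici] at hx
    have h1 := hanti (le_of_lt hx : (0 : ℝ) ≤ x)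
    simp only [mul_zero, sub_zero, ← hm] at h1
    rw [(hd x).deriv]
    linarith
  have hfin := hanti' (mem_Ici.2 le_rfl) (mem_Ici.2 zero_le_one) zero_le_one
  simp only [mul_one, one_pow, mul_zero, ne_eq, OfNat.ofNat_ne_zero, not_false_eq_true, zero_pow,
    sub_zero] at hfin
  have hZ1 : Z 1 = ∑ j, w j * Real.exp (r j) := by simp [hZ]
  have hZ0 : Z 0 = ∑ j, w j := by simp [hZ]
  have hZ10 : Z₁ 0 = ∑ j, w j * r j := by simp [hZ₁]
  rw [← hZ1, ← hZ0, ← hZ10]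
  linarith

/-- Entropic stability: a covariance bound along all exponential tilts controls the shift of the
barycenter by the entropy. -/
lemma barycenter_shift_sq_le {w F : ι → ℝ} (hw : ∀ j, 0 < w j) (hF : ∀ j, 0 < F j)
    (y : ι → V → ℝ) {c : ℝ} (hc : 0 < c)
    (hcov : ∀ h u : V → ℝ, ∑ j, w j * Real.exp (h ⬝ᵥ y j) * (u ⬝ᵥ y j
      - (∑ j, w j * Real.exp (h ⬝ᵥ y j) * (u ⬝ᵥ y j)) / ∑ j, w j * Real.exp (h ⬝ᵥ y j)) ^ 2
      ≤ c * (u ⬝ᵥ u) * ∑ j, w j * Real.exp (h ⬝ᵥ y j))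
    {D : V → ℝ} (hD : ∀ u : V → ℝ, u ⬝ᵥ D = (∑ j, w j * (u ⬝ᵥ y j) * F j) / (∑ j, w j * F j)
      - (∑ j, w j * (u ⬝ᵥ y j)) / ∑ j, w j) :
    (∑ j, w j * F j) * (D ⬝ᵥ D) ≤ 2 * c * wEnt w F := by
  have hX : 0 < ∑ j, w j * F j :=
    Finset.sum_pos (fun j _ => mul_pos (hw j) (hF j)) Finset.univ_nonempty
  have hu : ∀ u : V → ℝ, (∑ j, w j * F j) * (u ⬝ᵥ D)
      ≤ wEnt w F + (∑ j, w j * F j) * (c * (u ⬝ᵥ u) / 2) := fun u => by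
    have h1 := sum_mul_le_wEnt_add hw hF fun j => u ⬝ᵥ y j
    have h2 := log_sum_exp_sub_le (r := fun j => u ⬝ᵥ y j) (c := c * (u ⬝ᵥ u)) hw fun x => by
      simpa only [smul_dotProduct, smul_eq_mul] using hcov (x • u) u
    have h3 := mul_le_mul_of_nonneg_left h2 hX.le
    have h4 : ∑ j, w j * (u ⬝ᵥ y j) * F j = ∑ j, w j * F j * (u ⬝ᵥ y j) :=
      Finset.sum_congr rfl fun j _ => by ring
    rw [hD, h4, mul_sub, mul_div_cancel₀ _ hX.ne']
    linarith
  have h1 := hu (c⁻¹ • D)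
  simp only [smul_dotProduct, dotProduct_smul, smul_eq_mul] at h1
  have h2 : c * (c⁻¹ * (c⁻¹ * (D ⬝ᵥ D))) / 2 = c⁻¹ * (D ⬝ᵥ D) / 2 := by
    rw [← mul_assoc, mul_inv_cancel₀ hc.ne', one_mul]
  rw [h2] at h1
  have h3 : (∑ j, w j * F j) * (D ⬝ᵥ D)
      = 2 * c * ((∑ j, w j * F j) * (c⁻¹ * (D ⬝ᵥ D))
        - (∑ j, w j * F j) * (c⁻¹ * (D ⬝ᵥ D) / 2)) := by
    field_simp
    ring
  rw [h3]
  exact mul_le_mul_of_nonneg_left (by linarith) (by positivity)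

end Entropy

/-! ### Tensorization of entropy for product weights -/

lemma condMean_pos {w F : (V → Bool) → ℝ} (hw : ∀ σ, 0 < w σ) (hF : ∀ σ, 0 < F σ) (i : V)
    (σ : V → Bool) : 0 < condMean w F i σ :=
  div_pos (Finset.sum_pos (fun _ _ => mul_pos (hw _) (hF _)) Finset.univ_nonempty)
    (sum_bool_pos hw i σ)

lemma sum_condMean {w : (V → Bool) → ℝ} (hw : ∀ σ, 0 < w σ) (i : V) (F : (V → Bool) → ℝ) :
    ∑ σ, w σ * condMean w F i σ = ∑ σ, w σ * F σ := by
  simpa using sum_mul_condMean hw i (c := fun _ => 1) (fun _ _ => rfl) F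

lemma siteEntTerm_eq {w F : (V → Bool) → ℝ} (hw : ∀ σ, 0 < w σ) (i : V) :
    siteEntTerm w F i
      = ∑ σ, w σ * (F σ * (Real.log (F σ) - Real.log (condMean w F i σ))) := by
  have h := sum_mul_condMean hw i (c := fun σ => Real.log (condMean w F i σ))
    (fun σ b => by rw [condMean_update]) F
  rw [siteEntTerm, ← sub_eq_zero, ← Finset.sum_sub_distrib]
  rw [← sub_eq_zero, ← Finset.sum_sub_distrib, ← neg_eq_zero, ← Finset.sum_neg_distrib] at h
  rw [← h]
  exact Finset.sum_congr rfl fun σ _ => by ring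

/-- The single-site entropy term is the average of the entropies along the fibres. -/
lemma siteEntTerm_eq_sum_wEnt {w F : (V → Bool) → ℝ} (hw : ∀ σ, 0 < w σ) (hF : ∀ σ, 0 < F σ)
    (i : V) :
    siteEntTerm w F i = 1 / 2 * ∑ σ, wEnt (fun b => w (Function.update σ i b))
      (fun b => F (Function.update σ i b)) := by
  suffices h : 2 * siteEntTerm w F i = ∑ σ, wEnt (fun b => w (Function.update σ i b))
      (fun b => F (Function.update σ i b)) by linarith
  rw [siteEntTerm, ← sum_update_eq_two_mul _ i]
  refine Finset.sum_congr rfl fun σ _ => ?_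
  have hY := sum_bool_pos hw i σ
  have hX : 0 < ∑ b, w (Function.update σ i b) * F (Function.update σ i b) :=
    Finset.sum_pos (fun _ _ => mul_pos (hw _) (hF _)) Finset.univ_nonempty
  simp only [condMean_update, mul_sub, Finset.sum_sub_distrib, ← Finset.sum_mul]
  rw [wEnt, condMean, Real.log_div hX.ne' hY.ne', ← mul_assoc, mul_div_cancel₀ _ hY.ne']

lemma sum_mul_log_sub_log_condMean_le {w F g : (V → Bool) → ℝ} (hw : ∀ σ, 0 < w σ)
    (hF : ∀ σ, 0 < F σ) (hg : ∀ σ, 0 < g σ) (i : V) :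
    ∑ σ, w σ * (F σ * (Real.log (g σ) - Real.log (condMean w g i σ))) ≤ siteEntTerm w F i := by
  rw [siteEntTerm_eq hw, ← sub_nonneg, ← Finset.sum_sub_distrib]
  have h1 := sum_mul_condMean hw i (c := fun σ => condMean w F i σ / condMean w g i σ)
    (fun σ b => by simp only [condMean_update]) g
  have h2 := sum_condMean hw i F
  have h3 : ∑ σ, w σ * (condMean w F i σ / condMean w g i σ * condMean w g i σ)
      = ∑ σ, w σ * condMean w F i σ :=
    Finset.sum_congr rfl fun σ _ => by rw [div_mul_cancel₀ _ (condMean_pos hw hg i σ).ne']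
  have h4 : ∑ σ, w σ * (F σ - condMean w F i σ / condMean w g i σ * g σ) = 0 := by
    simp only [mul_sub, Finset.sum_sub_distrib]
    linarith
  rw [← h4]
  refine Finset.sum_le_sum fun σ _ => ?_
  rw [← mul_sub]
  refine mul_le_mul_of_nonneg_left ?_ (hw σ).le
  have hc := condMean_pos hw hF i σ
  have hg' := condMean_pos hw hg i σ
  have h5 := mul_log_sub_log_ge (hF σ) (mul_pos (div_pos hc hg') (hg σ))
  rw [Real.log_mul (div_pos hc hg').ne' (hg σ).ne', Real.log_div hc.ne' hg'.ne'] at h5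
  linarith

/-- Tensorization of entropy with constant `1` when the spins are independent. -/
lemma wEnt_le_sum_siteEntTerm {w F : (V → Bool) → ℝ} (hw : ∀ σ, 0 < w σ) (hF : ∀ σ, 0 < F σ)
    (hprod : ∀ i j, i ≠ j → ∀ σ b, siteProb w i (Function.update σ j b) = siteProb w i σ) :
    wEnt w F ≤ ∑ i, siteEntTerm w F i := by
  have key : ∀ s : Finset V, ∃ g : (V → Bool) → ℝ, (∀ σ, 0 < g σ) ∧
      (∀ i ∈ s, ∀ σ b, g (Function.update σ i b) = g σ) ∧
      ∑ σ, w σ * g σ = ∑ σ, w σ * F σ ∧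
      ∑ σ, w σ * (F σ * (Real.log (F σ) - Real.log (g σ))) ≤ ∑ i ∈ s, siteEntTerm w F i := by
    intro s
    induction s using Finset.induction_on with
    | empty => exact ⟨F, hF, by simp, rfl, by simp⟩
    | insert i s hi ih =>
      obtain ⟨g, hg, hind, hsum, hent⟩ := ih
      refine ⟨condMean w g i, condMean_pos hw hg i, fun j hj σ b => ?_,
        (sum_condMean hw i g).trans hsum, ?_⟩
      · by_cases hij : i = j
        · subst hij; exact condMean_update w g i σ b
        · have hjs : j ∈ s := (Finset.mem_insert.1 hj).resolve_left (Ne.symm hij)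
          rw [condMean_eq_siteProb hw, condMean_eq_siteProb hw, hprod i j hij,
            Function.update_comm (Ne.symm hij), Function.update_comm (Ne.symm hij),
            hind j hjs, hind j hjs]
      · rw [Finset.sum_insert hi]
        refine le_trans (le_of_eq ?_) (add_le_add (sum_mul_log_sub_log_condMean_le hw hF hg i) hent)
        rw [← Finset.sum_add_distrib]
        exact Finset.sum_congr rfl fun σ _ => by ring
  obtain ⟨g, hg, hind, hsum, hent⟩ := key Finset.univ
  set σ₀ : V → Bool := fun _ => true
  have hconst : ∀ σ, g σ = g σ₀ := fun σ =>
    eq_of_forall_update_eq (fun i σ b => hind i (Finset.mem_univ i) σ b) σ σ₀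
  have hX : 0 < ∑ σ, w σ * F σ :=
    Finset.sum_pos (fun σ _ => mul_pos (hw σ) (hF σ)) Finset.univ_nonempty
  have hY : 0 < ∑ σ, w σ := Finset.sum_pos (fun σ _ => hw σ) Finset.univ_nonempty
  simp only [hconst, ← Finset.sum_mul] at hsum hent
  have hlog : Real.log (g σ₀) = Real.log (∑ σ, w σ * F σ) - Real.log (∑ σ, w σ) := by
    rw [← hsum, Real.log_mul hY.ne' (hg σ₀).ne']; ring
  refine le_trans (le_of_eq ?_) hent
  rw [wEnt, ← hlog, Finset.sum_mul, ← Finset.sum_sub_distrib]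
  exact Finset.sum_congr rfl fun σ _ => by ring

/-! ### Ising weights -/

/-- The `±1`-valued spin configuration. -/
def spinVec (σ : V → Bool) : V → ℝ := fun v => if σ v then 1 else -1

lemma spinVec_update_true (σ : V → Bool) (i : V) :
    spinVec (Function.update σ i true) = spinVec (Function.update σ i false) + Pi.single i 2 := by
  ext v
  by_cases hv : v = i
  · subst hv; norm_num [spinVec]
  · simp [spinVec, hv]

lemma dotProduct_spinVec_update_true (x : V → ℝ) (σ : V → Bool) (i : V) :
    x ⬝ᵥ spinVec (Function.update σ i true)
      = x ⬝ᵥ spinVec (Function.update σ i false) + 2 * x i := by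
  rw [spinVec_update_true, dotProduct_add, dotProduct_single, mul_comm 2]

lemma lipschitz_sigmoid : LipschitzWith (1 / 4) Real.sigmoid := by
  refine lipschitzWith_of_nnnorm_deriv_le differentiable_sigmoid fun x => ?_
  rw [← NNReal.coe_le_coe, coe_nnnorm, Real.deriv_sigmoid, Real.norm_eq_abs, abs_of_nonneg
    (mul_nonneg (Real.sigmoid_nonneg x) (sub_nonneg.2 (Real.sigmoid_le_one x)))]
  push_cast
  nlinarith [sq_nonneg (Real.sigmoid x - 1 / 2)]

lemma siteProb_exp (E : (V → Bool) → ℝ) (i : V) (σ : V → Bool) :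
    siteProb (fun σ => Real.exp (E σ)) i σ = Real.sigmoid (spinDiff E i σ) := by
  rw [siteProb, Real.sigmoid_def, spinDiff, neg_sub, Real.exp_sub, Fintype.sum_bool]
  have := Real.exp_pos (E (Function.update σ i true))
  have := Real.exp_pos (E (Function.update σ i false))
  field_simp

/-- The Ising weight with interaction `t * ∑ₖ aₖ aₖᵀ` and external field `h`. -/
def isingWeight {K : Type*} [Fintype K] (a : K → V → ℝ) (t : ℝ) (h : V → ℝ)
    (σ : V → Bool) : ℝ :=
  gaussTilt a (spinVec σ) t h

section Ising

variable {K : Type*} [Fintype K] {a : K → V → ℝ}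

lemma isingWeight_pos (t : ℝ) (h : V → ℝ) (σ : V → Bool) : 0 < isingWeight a t h σ :=
  gaussTilt_pos a _ _ _

lemma siteProb_isingWeight (t : ℝ) (h : V → ℝ) (i : V) (σ : V → Bool) :
    siteProb (isingWeight a t h) i σ = Real.sigmoid (spinDiff (fun σ =>
      t / 2 * ∑ k, (a k ⬝ᵥ spinVec σ) ^ 2 + h ⬝ᵥ spinVec σ) i σ) :=
  siteProb_exp _ i σ

lemma spinDiff_energy (t : ℝ) (h : V → ℝ) (i : V) (σ : V → Bool) :
    spinDiff (fun σ => t / 2 * ∑ k, (a k ⬝ᵥ spinVec σ) ^ 2 + h ⬝ᵥ spinVec σ) i σ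
      = 2 * t * ∑ k, (a k i ^ 2 + a k i * (a k ⬝ᵥ spinVec (Function.update σ i false)))
        + 2 * h i := by
  simp only [spinDiff, dotProduct_spinVec_update_true]
  have h1 : ∀ k, (a k ⬝ᵥ spinVec (Function.update σ i false) + 2 * a k i) ^ 2
      = (a k ⬝ᵥ spinVec (Function.update σ i false)) ^ 2
        + 4 * (a k i ^ 2 + a k i * (a k ⬝ᵥ spinVec (Function.update σ i false))) :=
    fun k => by ring
  simp only [h1, Finset.sum_add_distrib, ← Finset.mul_sum]
  ring

lemma abs_spinDiff_siteProb_isingWeight_le {t : ℝ} (ht : t ∈ Icc (0 : ℝ) 1) (h : V → ℝ)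
    {i j : V} (hij : i ≠ j) (σ : V → Bool) :
    |spinDiff (siteProb (isingWeight a t h) i) j σ| ≤ |∑ k, a k i * a k j| := by
  have h1 := lipschitz_sigmoid.dist_le_mul
    (spinDiff (fun σ => t / 2 * ∑ k, (a k ⬝ᵥ spinVec σ) ^ 2 + h ⬝ᵥ spinVec σ) i
      (Function.update σ j true))
    (spinDiff (fun σ => t / 2 * ∑ k, (a k ⬝ᵥ spinVec σ) ^ 2 + h ⬝ᵥ spinVec σ) i
      (Function.update σ j false))
  rw [← siteProb_isingWeight, ← siteProb_isingWeight, Real.dist_eq, Real.dist_eq] at h1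
  refine h1.trans ?_
  have h3 : ∀ x : V → ℝ, x ⬝ᵥ spinVec (Function.update (Function.update σ j true) i false)
      = x ⬝ᵥ spinVec (Function.update (Function.update σ j false) i false) + 2 * x j := fun x => by
    rw [Function.update_comm hij.symm, Function.update_comm hij.symm,
      dotProduct_spinVec_update_true]
  have h4 : ∀ S T P : ℝ, 2 * t * (S + 2 * P) + T - (2 * t * S + T) = 4 * t * P :=
    fun S T P => by ring
  simp only [spinDiff_energy, h3]
  have h5 : ∀ y : K → ℝ, ∑ k, (a k i ^ 2 + a k i * (y k + 2 * a k j))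
      = ∑ k, (a k i ^ 2 + a k i * y k) + 2 * ∑ k, a k i * a k j := fun y => by
    rw [Finset.mul_sum, ← Finset.sum_add_distrib]
    exact Finset.sum_congr rfl fun k _ => by ring
  rw [h5, h4, abs_mul, abs_mul, abs_of_nonneg ht.1]
  push_cast
  rw [abs_of_pos (by norm_num : (0 : ℝ) < 4)]
  have := mul_le_mul_of_nonneg_right ht.2 (abs_nonneg (∑ k, a k i * a k j))
  linarith

lemma siteProb_isingWeight_zero_update (h : V → ℝ) (i j : V) (σ : V → Bool) (b : Bool) :
    siteProb (isingWeight a 0 h) i (Function.update σ j b)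
      = siteProb (isingWeight a 0 h) i σ := by
  simp only [siteProb_isingWeight, spinDiff_energy, mul_zero, zero_mul]

lemma siteVarTerm_dotProduct_spinVec_le {w : (V → Bool) → ℝ} (hw : ∀ σ, 0 < w σ) (u : V → ℝ)
    (i : V) : siteVarTerm w (fun σ => u ⬝ᵥ spinVec σ) i ≤ u i ^ 2 * ∑ σ, w σ := by
  suffices h : 2 * siteVarTerm w (fun σ => u ⬝ᵥ spinVec σ) i ≤ u i ^ 2 * (2 * ∑ σ, w σ) by
    linarith
  rw [siteVarTerm, ← sum_update_eq_two_mul _ i, ← sum_update_eq_two_mul w i, Finset.mul_sum]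
  refine Finset.sum_le_sum fun σ _ => ?_
  simp only [condMean_update]
  rw [condMean_eq_siteProb hw, siteProb]
  simp only [Fintype.sum_bool, dotProduct_spinVec_update_true]
  set A := w (Function.update σ i true)
  set B := w (Function.update σ i false)
  have hA : 0 < A := hw _
  have hB : 0 < B := hw _
  set x := u ⬝ᵥ spinVec (Function.update σ i false)
  have h1 : A * (x + 2 * u i - (A / (A + B) * (x + 2 * u i) + (1 - A / (A + B)) * x)) ^ 2
      + B * (x - (A / (A + B) * (x + 2 * u i) + (1 - A / (A + B)) * x)) ^ 2
      = u i ^ 2 * (4 * A * B / (A + B)) := by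
    field_simp; ring
  rw [h1]
  refine mul_le_mul_of_nonneg_left ?_ (sq_nonneg _)
  rw [div_le_iff₀ (by positivity)]
  nlinarith [sq_nonneg (A - B)]

/-- Approximate tensorization of variance for Ising weights. -/
lemma variance_tensorization_isingWeight
    (ha : ∀ j, ∑ i, (if i = j then 0 else |∑ k, a k i * a k j|) ≤ 1 / 4) {t : ℝ}
    (ht : t ∈ Icc (0 : ℝ) 1) (h : V → ℝ) (f : (V → Bool) → ℝ) :
    ∑ σ, isingWeight a t h σ * (f σ - (∑ τ, isingWeight a t h τ * f τ)
        / ∑ τ, isingWeight a t h τ) ^ 2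
      ≤ 4 / 3 * ∑ i, siteVarTerm (isingWeight a t h) f i := by
  have h1 := variance_tensorization (isingWeight_pos t h)
    (R := fun i j => if i = j then 0 else |∑ k, a k i * a k j|)
    (fun i j => by split_ifs <;> positivity)
    (fun i j hij σ => by
      rw [if_neg hij]; exact abs_spinDiff_siteProb_isingWeight_le ht h hij σ) ha f
  linarith

lemma covariance_isingWeight_le
    (ha : ∀ j, ∑ i, (if i = j then 0 else |∑ k, a k i * a k j|) ≤ 1 / 4) {t : ℝ}
    (ht : t ∈ Icc (0 : ℝ) 1) (h u : V → ℝ) :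
    ∑ σ, isingWeight a t h σ * (u ⬝ᵥ spinVec σ - (∑ τ, isingWeight a t h τ * (u ⬝ᵥ spinVec τ))
        / ∑ τ, isingWeight a t h τ) ^ 2
      ≤ 4 / 3 * (u ⬝ᵥ u) * ∑ σ, isingWeight a t h σ := by
  refine (variance_tensorization_isingWeight ha ht h _).trans ?_
  rw [mul_assoc]
  refine mul_le_mul_of_nonneg_left ?_ (by norm_num)
  rw [dotProduct, Finset.sum_mul]
  refine Finset.sum_le_sum fun i _ => ?_
  rw [← sq]
  exact siteVarTerm_dotProduct_spinVec_le (isingWeight_pos t h) u i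

/-- The entropy of an Ising weight satisfies a differential inequality for the heat operator. -/
lemma hasHeatAt_wEnt_isingWeight
    (ha : ∀ j, ∑ i, (if i = j then 0 else |∑ k, a k i * a k j|) ≤ 1 / 4)
    (ha' : ∀ x : V → ℝ, ∑ k, (a k ⬝ᵥ x) ^ 2 ≤ 1 / 2 * (x ⬝ᵥ x)) {F : (V → Bool) → ℝ}
    (hF : ∀ σ, 0 < F σ) {t : ℝ} (ht : t ∈ Icc (0 : ℝ) 1) (h : V → ℝ) :
    ∃ ℓ ≤ 2 / 3 * wEnt (isingWeight a t h) F,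
      HasHeatAt a (fun s k => wEnt (isingWeight a s k) F) ℓ t h := by
  refine ⟨_, ?_, hasHeatAt_wEnt a spinVec hF t h⟩
  have hw := isingWeight_pos (a := a) t h
  change 1 / 2 * (∑ σ, isingWeight a t h σ * F σ) * ∑ k,
    ((∑ σ, isingWeight a t h σ * (a k ⬝ᵥ spinVec σ) * F σ) / (∑ σ, isingWeight a t h σ * F σ)
      - (∑ σ, isingWeight a t h σ * (a k ⬝ᵥ spinVec σ)) / ∑ σ, isingWeight a t h σ) ^ 2 ≤ _
  set w := isingWeight a t h with hwdef
  set D : V → ℝ := (∑ σ, w σ * F σ)⁻¹ • ∑ σ, (w σ * F σ) • spinVec σ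
    - (∑ σ, w σ)⁻¹ • ∑ σ, w σ • spinVec σ with hDdef
  have hD : ∀ u : V → ℝ, u ⬝ᵥ D = (∑ σ, w σ * (u ⬝ᵥ spinVec σ) * F σ) / (∑ σ, w σ * F σ)
      - (∑ σ, w σ * (u ⬝ᵥ spinVec σ)) / ∑ σ, w σ := fun u => by
    simp only [hDdef, dotProduct_sub, dotProduct_smul, dotProduct_sum, smul_eq_mul]
    rw [div_eq_inv_mul, div_eq_inv_mul]
    congr 2
    exact Finset.sum_congr rfl fun σ _ => by ring
  have htilt : ∀ k σ, w σ * Real.exp (k ⬝ᵥ spinVec σ) = isingWeight a t (h + k) σ :=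
    fun k σ => by
      rw [hwdef, isingWeight, gaussTilt, isingWeight, gaussTilt, ← Real.exp_add, add_dotProduct,
        add_assoc]
  have h1 := barycenter_shift_sq_le hw hF spinVec (c := 4 / 3) (by norm_num)
    (fun k u => by simp only [htilt]; exact covariance_isingWeight_le ha ht _ u) hD
  simp only [← hD]
  have hX : 0 < ∑ σ, w σ * F σ :=
    Finset.sum_pos (fun σ _ => mul_pos (hw σ) (hF σ)) Finset.univ_nonempty
  have h2 := mul_le_mul_of_nonneg_left (ha' D) hX.le
  linarith

end Ising

/-! ### Approximate tensorization of entropy for positive Ising weights -/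

section Interpolation

variable {K : Type*} [Fintype K] {a : K → V → ℝ}

lemma spinVec_dotProduct_self (σ : V → Bool) : spinVec σ ⬝ᵥ spinVec σ = (Fintype.card V : ℝ) := by
  have h : ∀ v, spinVec σ v * spinVec σ v = 1 := fun v => by
    simp only [spinVec]; split_ifs <;> norm_num
  simp [dotProduct, h]

lemma exists_norm_le_dotProduct_spinVec (h : V → ℝ) : ∃ σ : V → Bool, ‖h‖ ≤ h ⬝ᵥ spinVec σ := by
  refine ⟨fun v => decide (0 ≤ h v), ?_⟩
  have habs : ∀ v, h v * spinVec (fun v => decide (0 ≤ h v)) v = |h v| := fun v => by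
    rcases le_or_gt 0 (h v) with hv | hv
    · simp [spinVec, hv, abs_of_nonneg hv]
    · simp [spinVec, not_le.2 hv, abs_of_neg hv]
  simp only [dotProduct, habs]
  refine (pi_norm_le_iff_of_nonneg (Finset.sum_nonneg fun v _ => abs_nonneg _)).2 fun v => ?_
  exact Finset.single_le_sum (f := fun v => |h v|) (fun v _ => abs_nonneg _) (Finset.mem_univ v)

lemma continuous_wEnt_gaussTilt {ι : Type*} [Fintype ι] [Nonempty ι] (a : K → V → ℝ)
    (y : ι → V → ℝ) {F : ι → ℝ} (hF : ∀ j, 0 < F j) :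
    Continuous fun p : ℝ × (V → ℝ) => wEnt (fun j => gaussTilt a (y j) p.1 p.2) F := by
  have hw : ∀ j, Continuous fun p : ℝ × (V → ℝ) => gaussTilt a (y j) p.1 p.2 := fun j => by
    simp only [gaussTilt, dotProduct]
    fun_prop
  have hX : Continuous fun p : ℝ × (V → ℝ) => ∑ j, gaussTilt a (y j) p.1 p.2 * F j :=
    continuous_finsetSum _ fun j _ => (hw j).mul continuous_const
  have hY : Continuous fun p : ℝ × (V → ℝ) => ∑ j, gaussTilt a (y j) p.1 p.2 :=
    continuous_finsetSum _ fun j _ => hw j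
  refine (continuous_finsetSum _ fun j _ => (hw j).mul continuous_const).sub
    (hX.mul ((hX.log fun p => ?_).sub (hY.log fun p => ?_)))
  · exact (Finset.sum_pos (fun j _ => mul_pos (gaussTilt_pos _ _ _ _) (hF j))
      Finset.univ_nonempty).ne'
  · exact (Finset.sum_pos (fun j _ => gaussTilt_pos _ _ _ _) Finset.univ_nonempty).ne'

lemma hasHeatAt_exp (C : ℝ) (z : V → ℝ) (t : ℝ) (h : V → ℝ) :
    HasHeatAt a (fun s k => Real.exp (C * s + k ⬝ᵥ z))
      (Real.exp (C * t + h ⬝ᵥ z) * (C - 1 / 2 * ∑ k, (a k ⬝ᵥ z) ^ 2)) t h := by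
  have hsp : ∀ k x, HasDerivAt (fun r : ℝ => Real.exp (C * t + (h + r • a k) ⬝ᵥ z))
      (Real.exp (C * t + (h + x • a k) ⬝ᵥ z) * (a k ⬝ᵥ z)) x := fun k x => by
    have h1 : HasDerivAt (fun r : ℝ => C * t + (h + r • a k) ⬝ᵥ z) (a k ⬝ᵥ z) x := by
      simp only [add_dotProduct, smul_dotProduct, smul_eq_mul]
      simpa using (((hasDerivAt_id x).mul_const (a k ⬝ᵥ z)).const_add (h ⬝ᵥ z)).const_add (C * t)
    exact h1.exp
  have htm : HasDerivAt (fun s => C * s + h ⬝ᵥ z) C t := by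
    simpa using ((hasDerivAt_id t).const_mul C).add_const (h ⬝ᵥ z)
  refine ⟨_, _, _, htm.exp, hsp, fun k => (hsp k 0).mul_const (a k ⬝ᵥ z), ?_⟩
  simp only [zero_smul, add_zero, mul_assoc, ← Finset.mul_sum, ← sq]
  ring

/-- Along the interpolation, `exp (-2t/3)` times the entropy minus the single-site entropies is
nonpositive. -/
lemma exp_mul_wEnt_isingWeight_le
    (ha : ∀ j, ∑ i, (if i = j then 0 else |∑ k, a k i * a k j|) ≤ 1 / 4)
    (ha' : ∀ x : V → ℝ, ∑ k, (a k ⬝ᵥ x) ^ 2 ≤ 1 / 2 * (x ⬝ᵥ x)) {F : (V → Bool) → ℝ}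
    (hF : ∀ σ, 0 < F σ) {t : ℝ} (ht : t ∈ Icc (0 : ℝ) 1) (h : V → ℝ) :
    Real.exp (-(2 / 3) * t) * wEnt (isingWeight a t h) F
      ≤ ∑ i, siteEntTerm (isingWeight a t h) F i := by
  set N : ℝ := (Fintype.card V : ℝ) with hN
  have hN0 : 0 ≤ N := Nat.cast_nonneg _
  have hquad : ∀ σ : V → Bool, ∑ k, (a k ⬝ᵥ spinVec σ) ^ 2 ≤ 1 / 2 * N := fun σ => by
    simpa only [spinVec_dotProduct_self] using ha' (spinVec σ)
  have hquad2 : ∀ σ : V → Bool, ∑ k, (a k ⬝ᵥ ((2 : ℝ) • spinVec σ)) ^ 2 ≤ 2 * N := fun σ => by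
    simp only [dotProduct_smul, smul_eq_mul, mul_pow, ← Finset.mul_sum]
    linarith [hquad σ]
  let ψ : ℝ → (V → ℝ) → ℝ := fun s k =>
    ∑ σ : V → Bool, Real.exp ((N + 1) * s + k ⬝ᵥ ((2 : ℝ) • spinVec σ))
  have hψ : ∀ s k, 0 < ψ s k := fun s k =>
    Finset.sum_pos (fun σ _ => Real.exp_pos _) Finset.univ_nonempty
  let S : ℝ → (V → ℝ) → ℝ := fun s k => ∑ i, ∑ σ, 1 / 2 *
    wEnt (fun b => gaussTilt a (spinVec (Function.update σ i b)) s k)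
      (fun b => F (Function.update σ i b))
  have hS : ∀ s k, S s k = ∑ i, siteEntTerm (isingWeight a s k) F i := fun s k =>
    Finset.sum_congr rfl fun i _ => by
      rw [siteEntTerm_eq_sum_wEnt (isingWeight_pos s k) hF, Finset.mul_sum]; rfl
  have hS0 : ∀ s k, 0 ≤ S s k := fun s k =>
    Finset.sum_nonneg fun i _ => Finset.sum_nonneg fun σ _ => mul_nonneg (by norm_num)
      (wEnt_nonneg (fun b => gaussTilt_pos _ _ _ _) fun b => hF _)
  let U : ℝ → (V → ℝ) → ℝ := fun s k => wEnt (isingWeight a s k) F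
  have hU0 : ∀ s k, 0 ≤ U s k := fun s k => wEnt_nonneg (isingWeight_pos s k) hF
  rw [← hS]
  suffices key : ∀ ε > 0, Real.exp (-(2 / 3) * t) * U t h - S t h - ε * ψ t h ≤ 0 by
    refine le_of_forall_pos_le_add fun δ hδ => ?_
    have h1 := key (δ / ψ t h) (div_pos hδ (hψ t h))
    rw [div_mul_cancel₀ _ (hψ t h).ne'] at h1
    linarith
  intro ε hε
  let B : (V → Bool) → ℝ := fun σ => Real.exp N * |F σ * Real.log (F σ) - F σ + 1|
  refine heat_max_principle (a := a) (R := (∑ σ, B σ ^ 2) / ε ^ 2)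
    (v := fun s k => Real.exp (-(2 / 3) * s) * U s k - S s k - ε * ψ s k)
    ?_ (fun k => ?_) (fun s hs k => ?_) (fun s hs k hk => ?_) ht h
  · have hUc : Continuous fun p : ℝ × (V → ℝ) => U p.1 p.2 :=
      continuous_wEnt_gaussTilt a spinVec hF
    have hSc : Continuous fun p : ℝ × (V → ℝ) => S p.1 p.2 :=
      continuous_finsetSum _ fun i _ => continuous_finsetSum _ fun σ _ =>
        continuous_const.mul (continuous_wEnt_gaussTilt a
          (fun b => spinVec (Function.update σ i b)) fun b => hF _)
    have hψc : Continuous fun p : ℝ × (V → ℝ) => ψ p.1 p.2 := by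
      simp only [ψ, dotProduct]
      fun_prop
    fun_prop
  · have h1 := wEnt_le_sum_siteEntTerm (isingWeight_pos (a := a) 0 k) hF
      fun i j _ σ b => siteProb_isingWeight_zero_update k i j σ b
    rw [← hS] at h1
    have h2 := mul_pos hε (hψ 0 k)
    simp only [mul_zero, Real.exp_zero, one_mul]
    linarith
  · obtain ⟨ℓ, hℓ, hheat⟩ := hasHeatAt_wEnt_isingWeight ha ha' hF (Ioc_subset_Icc_self hs) k
    have hexp : HasDerivAt (fun r : ℝ => Real.exp (-(2 / 3) * r))
        (Real.exp (-(2 / 3) * s) * -(2 / 3)) s := by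
      simpa using ((hasDerivAt_id s).const_mul (-(2 / 3) : ℝ)).exp
    refine ⟨_, ?_, ((hheat.time_mul hexp).sub (HasHeatAt.sum fun i => HasHeatAt.sum fun σ =>
      (hasHeatAt_wEnt a (fun b => spinVec (Function.update σ i b))
        (F := fun b => F (Function.update σ i b)) (fun b => hF _) s k).const_mul (1 / 2))).sub
      ((HasHeatAt.sum fun σ : V → Bool =>
        hasHeatAt_exp (N + 1) ((2 : ℝ) • spinVec σ) s k).const_mul ε)⟩
    have h1 : Real.exp (-(2 / 3) * s) * -(2 / 3) * U s k + Real.exp (-(2 / 3) * s) * ℓ ≤ 0 := by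
      have := mul_le_mul_of_nonneg_left hℓ (Real.exp_pos (-(2 / 3) * s)).le
      simp only [U]
      linarith
    have h2 : 0 < ∑ σ : V → Bool, Real.exp ((N + 1) * s + k ⬝ᵥ ((2 : ℝ) • spinVec σ))
        * (N + 1 - 1 / 2 * ∑ j, (a j ⬝ᵥ ((2 : ℝ) • spinVec σ)) ^ 2) :=
      Finset.sum_pos (fun σ _ => mul_pos (Real.exp_pos _) (by linarith [hquad2 σ]))
        Finset.univ_nonempty
    have h3 := mul_pos hε h2
    refine sub_neg_of_lt (lt_of_le_of_lt (sub_le_self _ ?_) (h1.trans_lt h3))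
    refine Finset.sum_nonneg fun i _ => Finset.sum_nonneg fun σ _ => ?_
    have h4 : 0 ≤ ∑ b, gaussTilt a (spinVec (Function.update σ i b)) s k
        * F (Function.update σ i b) :=
      Finset.sum_nonneg fun b _ => mul_nonneg (gaussTilt_pos _ _ _ _).le (hF _).le
    positivity
  · set x : (V → Bool) → ℝ := fun σ => Real.exp (k ⬝ᵥ spinVec σ) with hx
    have hUle : U s k ≤ ∑ σ, x σ * B σ := by
      refine (wEnt_le (isingWeight_pos s k) hF).trans (Finset.sum_le_sum fun σ _ => ?_)
      have h1 : isingWeight a s k σ ≤ x σ * Real.exp N := by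
        rw [isingWeight, gaussTilt, hx, ← Real.exp_add]
        refine Real.exp_le_exp.2 ?_
        have h2 := mul_le_mul_of_nonneg_left (hquad σ) (by linarith [hs.1] : 0 ≤ s / 2)
        nlinarith [hs.2]
      calc isingWeight a s k σ * (F σ * Real.log (F σ) - F σ + 1)
          ≤ isingWeight a s k σ * |F σ * Real.log (F σ) - F σ + 1| :=
            mul_le_mul_of_nonneg_left (le_abs_self _) (isingWeight_pos s k σ).le
        _ ≤ x σ * Real.exp N * |F σ * Real.log (F σ) - F σ + 1| :=
            mul_le_mul_of_nonneg_right h1 (abs_nonneg _)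
        _ = x σ * B σ := mul_assoc _ _ _
    have hψge : ∑ σ, x σ ^ 2 ≤ ψ s k := Finset.sum_le_sum fun σ _ => by
      rw [hx, ← Real.exp_nat_mul]
      refine Real.exp_le_exp.2 ?_
      rw [dotProduct_smul, smul_eq_mul]
      push_cast
      linarith [mul_nonneg (by linarith : 0 ≤ N + 1) hs.1]
    obtain ⟨σ₀, hσ₀⟩ := exists_norm_le_dotProduct_spinVec k
    have hx₀ : (∑ σ, B σ ^ 2) / ε ^ 2 ≤ ∑ σ, x σ ^ 2 := by
      refine le_trans ?_ (Finset.single_le_sum (f := fun σ => x σ ^ 2)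
        (fun σ _ => sq_nonneg _) (Finset.mem_univ σ₀))
      have h1 : ‖k‖ + 1 ≤ x σ₀ := (Real.add_one_le_exp _).trans (Real.exp_le_exp.2 hσ₀)
      nlinarith [norm_nonneg k]
    rw [div_le_iff₀ (by positivity)] at hx₀
    have hyoung : ε * ∑ σ, x σ * B σ ≤ ∑ σ, B σ ^ 2 / 2 + ε ^ 2 * ∑ σ, x σ ^ 2 / 2 := by
      rw [Finset.mul_sum, Finset.mul_sum, ← Finset.sum_add_distrib]
      exact Finset.sum_le_sum fun σ _ => by nlinarith [sq_nonneg (B σ - ε * x σ)]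
    simp only [← Finset.sum_div] at hyoung
    have hle : ∑ σ, x σ * B σ ≤ ε * ∑ σ, x σ ^ 2 := by
      refine le_of_mul_le_mul_left (a := ε) ?_ hε
      linarith
    have hE : Real.exp (-(2 / 3) * s) * U s k ≤ U s k :=
      mul_le_of_le_one_left (hU0 s k) (Real.exp_le_one_iff.2 (by linarith [hs.1]))
    have h5 := mul_le_mul_of_nonneg_left hψge hε.le
    linarith [hS0 s k]

/-- Approximate tensorization of entropy for Ising weights. -/
lemma entropy_tensorization_isingWeight
    (ha : ∀ j, ∑ i, (if i = j then 0 else |∑ k, a k i * a k j|) ≤ 1 / 4)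
    (ha' : ∀ x : V → ℝ, ∑ k, (a k ⬝ᵥ x) ^ 2 ≤ 1 / 2 * (x ⬝ᵥ x)) {F : (V → Bool) → ℝ}
    (hF : ∀ σ, 0 < F σ) (h : V → ℝ) :
    wEnt (isingWeight a 1 h) F ≤ 2 * ∑ i, siteEntTerm (isingWeight a 1 h) F i := by
  have h1 := exp_mul_wEnt_isingWeight_le ha ha' hF (right_mem_Icc.2 zero_le_one) h
  have h2 : 1 / 2 ≤ Real.exp (-(2 / 3) * 1) := by
    rw [← Real.log_le_iff_le_exp (by norm_num), one_div, Real.log_inv]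
    linarith [Real.log_two_gt_d9]
  have h3 := mul_le_mul_of_nonneg_right h2 (wEnt_nonneg (isingWeight_pos (a := a) 1 h) hF)
  linarith

end Interpolation

/-! ### Reduction of pinned Ising models to positive Ising weights -/

section Reduction

lemma pMean_const_mul {w : (V → Bool) → ℝ} {c : ℝ} (hc : c * ∑ σ, w σ = 1)
    (f : (V → Bool) → ℝ) :
    pMean (fun σ => c * w σ) f = (∑ σ, w σ * f σ) / ∑ σ, w σ := by
  have hY : ∑ σ, w σ ≠ 0 := right_ne_zero_of_mul (hc ▸ one_ne_zero)
  simp only [pMean, mul_assoc, ← Finset.mul_sum]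
  rw [eq_div_iff hY, mul_right_comm, hc, one_mul]

lemma pVar_const_mul {w : (V → Bool) → ℝ} {c : ℝ} (hc : c * ∑ σ, w σ = 1)
    (f : (V → Bool) → ℝ) :
    pVar (fun σ => c * w σ) f
      = c * ∑ σ, w σ * (f σ - (∑ τ, w τ * f τ) / ∑ τ, w τ) ^ 2 := by
  rw [pVar, pMean_const_mul hc f]
  simp only [pMean, mul_assoc, ← Finset.mul_sum]

lemma pEnt_const_mul {w F : (V → Bool) → ℝ} (hw : ∀ σ, 0 < w σ) (hF : ∀ σ, 0 < F σ) {c : ℝ}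
    (hc : c * ∑ σ, w σ = 1) : pEnt (fun σ => c * w σ) F = c * wEnt w F := by
  have hX : 0 < ∑ σ, w σ * F σ :=
    Finset.sum_pos (fun σ _ => mul_pos (hw σ) (hF σ)) Finset.univ_nonempty
  have hY : 0 < ∑ σ, w σ := Finset.sum_pos (fun σ _ => hw σ) Finset.univ_nonempty
  rw [pEnt, pMean_const_mul hc F, Real.log_div hX.ne' hY.ne', wEnt]
  simp only [pMean, mul_assoc, ← Finset.mul_sum]
  have h1 : (∑ σ, w σ * F σ) / ∑ σ, w σ = c * ∑ σ, w σ * F σ := by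
    rw [div_eq_iff hY.ne', mul_right_comm, hc, one_mul]
  rw [h1]
  ring

lemma siteVarTerm_const_mul {c : ℝ} (hc : c ≠ 0) (w f : (V → Bool) → ℝ) (i : V) :
    siteVarTerm (fun σ => c * w σ) f i = c * siteVarTerm w f i := by
  simp only [siteVarTerm, condMean_smul_weight hc, mul_assoc, ← Finset.mul_sum]

lemma siteEntTerm_const_mul {c : ℝ} (hc : c ≠ 0) (w f : (V → Bool) → ℝ) (i : V) :
    siteEntTerm (fun σ => c * w σ) f i = c * siteEntTerm w f i := by
  simp only [siteEntTerm, condMean_smul_weight hc, mul_assoc, ← Finset.mul_sum]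

section Positive

variable {K : Type*} [Fintype K] {a : K → V → ℝ} {h : V → ℝ} {c : ℝ}

lemma pos_of_mul_sum_isingWeight (hc : c * ∑ σ, isingWeight a 1 h σ = 1) : 0 < c :=
  pos_of_mul_pos_left (hc ▸ one_pos)
    (Finset.sum_nonneg fun σ _ => (isingWeight_pos 1 h σ).le)

lemma pVar_isingWeight_le
    (ha : ∀ j, ∑ i, (if i = j then 0 else |∑ k, a k i * a k j|) ≤ 1 / 4)
    (hc : c * ∑ σ, isingWeight a 1 h σ = 1) (f : (V → Bool) → ℝ) :
    pVar (fun σ => c * isingWeight a 1 h σ) f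
      ≤ 2 * ∑ i, siteVarTerm (fun σ => c * isingWeight a 1 h σ) f i := by
  have hc0 := pos_of_mul_sum_isingWeight hc
  simp only [pVar_const_mul hc, siteVarTerm_const_mul hc0.ne', ← Finset.mul_sum]
  rw [mul_left_comm]
  refine mul_le_mul_of_nonneg_left ?_ hc0.le
  have h1 := variance_tensorization_isingWeight ha (right_mem_Icc.2 zero_le_one) h f
  have h2 : 0 ≤ ∑ i, siteVarTerm (isingWeight a 1 h) f i :=
    Finset.sum_nonneg fun i _ => Finset.sum_nonneg fun σ _ =>
      mul_nonneg (isingWeight_pos 1 h σ).le (sq_nonneg _)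
  linarith

lemma pEnt_isingWeight_le
    (ha : ∀ j, ∑ i, (if i = j then 0 else |∑ k, a k i * a k j|) ≤ 1 / 4)
    (ha' : ∀ x : V → ℝ, ∑ k, (a k ⬝ᵥ x) ^ 2 ≤ 1 / 2 * (x ⬝ᵥ x))
    (hc : c * ∑ σ, isingWeight a 1 h σ = 1) {F : (V → Bool) → ℝ} (hF : ∀ σ, 0 < F σ) :
    pEnt (fun σ => c * isingWeight a 1 h σ) F
      ≤ 2 * ∑ i, siteEntTerm (fun σ => c * isingWeight a 1 h σ) F i := by
  have hc0 := pos_of_mul_sum_isingWeight hc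
  simp only [pEnt_const_mul (isingWeight_pos 1 h) hF hc, siteEntTerm_const_mul hc0.ne',
    ← Finset.mul_sum]
  rw [mul_left_comm]
  exact mul_le_mul_of_nonneg_left (entropy_tensorization_isingWeight ha ha' hF h) hc0.le

end Positive

/-! #### Limits of single-site terms -/

lemma abs_condMean_le {w f : (V → Bool) → ℝ} (hw : ∀ σ, 0 < w σ) {M : ℝ}
    (hf : ∀ σ, |f σ| ≤ M) (i : V) (σ : V → Bool) : |condMean w f i σ| ≤ M := by
  rw [condMean, abs_div, abs_of_pos (sum_bool_pos hw i σ), div_le_iff₀ (sum_bool_pos hw i σ),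
    Finset.mul_sum]
  refine (Finset.abs_sum_le_sum_abs _ _).trans (Finset.sum_le_sum fun b _ => ?_)
  rw [abs_mul, abs_of_pos (hw _), mul_comm]
  exact mul_le_mul_of_nonneg_right (hf _) (hw _).le

lemma tendsto_sum_mul_condMean {p f : ℕ → (V → Bool) → ℝ} {p' f' : (V → Bool) → ℝ}
    (hpos : ∀ n σ, 0 < p n σ) (hp : ∀ σ, Tendsto (fun n => p n σ) atTop (𝓝 (p' σ)))
    (hf : ∀ σ, Tendsto (fun n => f n σ) atTop (𝓝 (f' σ))) {M : ℝ} (hM : ∀ n σ, |f n σ| ≤ M)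
    {Ψ : ℝ × ℝ → ℝ} (hΨ : Continuous Ψ) (i : V) :
    Tendsto (fun n => ∑ σ, p n σ * Ψ (f n σ, condMean (p n) (f n) i σ)) atTop
      (𝓝 (∑ σ, p' σ * Ψ (f' σ, condMean p' f' i σ))) := by
  have hp0 : ∀ σ, 0 ≤ p' σ := fun σ => ge_of_tendsto' (hp σ) fun n => (hpos n σ).le
  refine tendsto_finsetSum _ fun σ _ => ?_
  by_cases hD : ∑ b, p' (Function.update σ i b) = 0
  · have hσ : p' σ = 0 := by
      have := (Finset.sum_eq_zero_iff_of_nonneg fun b _ => hp0 _).1 hD (σ i) (Finset.mem_univ _)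
      rwa [Function.update_eq_self] at this
    obtain ⟨C, hC⟩ := (isCompact_Icc.prod isCompact_Icc).exists_bound_of_continuousOn
      (s := Icc (-M) M ×ˢ Icc (-M) M) hΨ.continuousOn
    have hlim : Tendsto (fun n => p n σ * C) atTop (𝓝 0) := by
      simpa [hσ] using (hp σ).mul_const C
    rw [hσ, zero_mul]
    refine squeeze_zero_norm (fun n => ?_) hlim
    rw [norm_mul, Real.norm_of_nonneg (hpos n σ).le]
    exact mul_le_mul_of_nonneg_left (hC _ ⟨abs_le.1 (hM n σ),
      abs_le.1 (abs_condMean_le (hpos n) (hM n) i σ)⟩) (hpos n σ).le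
  · have hcond : Tendsto (fun n => condMean (p n) (f n) i σ) atTop (𝓝 (condMean p' f' i σ)) :=
      (tendsto_finsetSum _ fun b _ => (hp _).mul (hf _)).div
        (tendsto_finsetSum _ fun b _ => hp _) hD
    exact (hp σ).mul ((hΨ.tendsto _).comp ((hf σ).prodMk_nhds hcond))

lemma tendsto_siteVarTerm {p : ℕ → (V → Bool) → ℝ} {p' : (V → Bool) → ℝ}
    (hpos : ∀ n σ, 0 < p n σ) (hp : ∀ σ, Tendsto (fun n => p n σ) atTop (𝓝 (p' σ)))
    (f : (V → Bool) → ℝ) (i : V) :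
    Tendsto (fun n => siteVarTerm (p n) f i) atTop (𝓝 (siteVarTerm p' f i)) :=
  tendsto_sum_mul_condMean (f := fun _ => f) (f' := f) (Ψ := fun z => (z.1 - z.2) ^ 2) hpos hp
    (fun _ => tendsto_const_nhds) (M := ‖f‖) (fun _ σ => norm_le_pi_norm f σ) (by fun_prop) i

lemma tendsto_siteEntTerm {p f : ℕ → (V → Bool) → ℝ} {p' f' : (V → Bool) → ℝ}
    (hpos : ∀ n σ, 0 < p n σ) (hp : ∀ σ, Tendsto (fun n => p n σ) atTop (𝓝 (p' σ)))
    (hf : ∀ σ, Tendsto (fun n => f n σ) atTop (𝓝 (f' σ))) {M : ℝ} (hM : ∀ n σ, |f n σ| ≤ M)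
    (i : V) :
    Tendsto (fun n => siteEntTerm (p n) (f n) i) atTop (𝓝 (siteEntTerm p' f' i)) :=
  tendsto_sum_mul_condMean (Ψ := fun z => z.1 * Real.log z.1 - z.2 * Real.log z.2) hpos hp hf hM
    ((Real.continuous_mul_log.comp continuous_fst).sub
      (Real.continuous_mul_log.comp continuous_snd)) i

lemma tendsto_pMean {p f : ℕ → (V → Bool) → ℝ} {p' f' : (V → Bool) → ℝ}
    (hp : ∀ σ, Tendsto (fun n => p n σ) atTop (𝓝 (p' σ)))
    (hf : ∀ σ, Tendsto (fun n => f n σ) atTop (𝓝 (f' σ))) :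
    Tendsto (fun n => pMean (p n) (f n)) atTop (𝓝 (pMean p' f')) :=
  tendsto_finsetSum _ fun σ _ => (hp σ).mul (hf σ)

lemma tendsto_pVar {p : ℕ → (V → Bool) → ℝ} {p' : (V → Bool) → ℝ}
    (hp : ∀ σ, Tendsto (fun n => p n σ) atTop (𝓝 (p' σ))) (f : (V → Bool) → ℝ) :
    Tendsto (fun n => pVar (p n) f) atTop (𝓝 (pVar p' f)) := by
  have hm : Tendsto (fun n => pMean (p n) f) atTop (𝓝 (pMean p' f)) :=
    tendsto_pMean (f := fun _ => f) hp fun _ => tendsto_const_nhds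
  exact tendsto_pMean (f := fun n σ => (f σ - pMean (p n) f) ^ 2) hp fun σ =>
    (hm.const_sub (f σ)).pow 2

lemma tendsto_pEnt {p f : ℕ → (V → Bool) → ℝ} {p' f' : (V → Bool) → ℝ}
    (hp : ∀ σ, Tendsto (fun n => p n σ) atTop (𝓝 (p' σ)))
    (hf : ∀ σ, Tendsto (fun n => f n σ) atTop (𝓝 (f' σ))) :
    Tendsto (fun n => pEnt (p n) (f n)) atTop (𝓝 (pEnt p' f')) :=
  (tendsto_pMean hp fun σ => (Real.continuous_mul_log.tendsto _).comp (hf σ)).sub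
    ((Real.continuous_mul_log.tendsto _).comp (tendsto_pMean hp hf))

end Reduction

/-! ### Factorization of the interaction -/

/-- Directions whose squares add up to the interaction `J / 4`, up to a diagonal term. -/
def interactionDir (J : V → V → ℝ) (e : V × V) : V → ℝ :=
  √(|J e.1 e.2| / 8) • (Pi.single e.1 1 + (SignType.sign (J e.1 e.2) : ℝ) • Pi.single e.2 1)

section Interaction

variable {J : V → V → ℝ}

lemma sum_interactionDir_mul (hJ : ∀ u v, J u v = J v u) (x y : V → ℝ) :
    ∑ e, (interactionDir J e ⬝ᵥ x) * (interactionDir J e ⬝ᵥ y)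
      = 1 / 4 * ∑ u, (∑ v, |J u v|) * (x u * y u) + 1 / 4 * ∑ u, ∑ v, J u v * x u * y v := by
  have hterm : ∀ u v, (interactionDir J (u, v) ⬝ᵥ x) * (interactionDir J (u, v) ⬝ᵥ y)
      = 1 / 8 * (|J u v| * (x u * y u)) + 1 / 8 * (|J v u| * (x v * y v))
        + 1 / 8 * (J u v * x u * y v) + 1 / 8 * (J v u * x v * y u) := fun u v => by
    have h1 := Real.mul_self_sqrt (div_nonneg (abs_nonneg (J u v)) (by norm_num : (0 : ℝ) ≤ 8))
    have h2 : |J u v| * (SignType.sign (J u v) : ℝ) = J u v := abs_mul_sign _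
    have h3 : J u v * (SignType.sign (J u v) : ℝ) = |J u v| := self_mul_sign _
    rw [hJ v u]
    simp only [interactionDir, smul_dotProduct, add_dotProduct, single_one_dotProduct, smul_eq_mul]
    generalize (SignType.sign (J u v) : ℝ) = s at h2 h3 ⊢
    linear_combination (x u + s * x v) * (y u + s * y v) * h1
      + 1 / 8 * (x u * y v + x v * y u + s * x v * y v) * h2 + 1 / 8 * (x v * y v) * h3
  rw [Fintype.sum_prod_type]
  simp only [hterm, Finset.sum_add_distrib]
  rw [Finset.sum_comm (f := fun u v => 1 / 8 * (|J v u| * (x v * y v))),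
    Finset.sum_comm (f := fun u v => 1 / 8 * (J v u * x v * y u))]
  simp only [← Finset.mul_sum, ← Finset.sum_mul]
  ring

lemma sum_abs_sum_interactionDir_le (hJ : ∀ u v, J u v = J v u)
    (hrow : ∀ u, ∑ v, |J u v| ≤ 1) (j : V) :
    ∑ i, (if i = j then 0 else |∑ e, interactionDir J e i * interactionDir J e j|) ≤ 1 / 4 := by
  have h1 : ∀ i, i ≠ j → ∑ e, interactionDir J e i * interactionDir J e j = 1 / 4 * J i j :=
    fun i hij => by
      have h2 := sum_interactionDir_mul hJ (Pi.single i 1) (Pi.single j 1)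
      simp only [dotProduct_single, mul_one] at h2
      rw [h2]
      simp [Pi.single_apply, hij.symm]
  calc ∑ i, (if i = j then 0 else |∑ e, interactionDir J e i * interactionDir J e j|)
      ≤ ∑ i, 1 / 4 * |J j i| := Finset.sum_le_sum fun i _ => by
        split_ifs with hij
        · positivity
        · rw [h1 i hij, abs_mul, hJ j i, abs_of_pos (by norm_num : (0 : ℝ) < 1 / 4)]
    _ ≤ 1 / 4 := by
        rw [← Finset.mul_sum]
        linarith [hrow j]

lemma sum_interactionDir_sq_le (hJ : ∀ u v, J u v = J v u) (hrow : ∀ u, ∑ v, |J u v| ≤ 1)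
    (x : V → ℝ) : ∑ e, (interactionDir J e ⬝ᵥ x) ^ 2 ≤ 1 / 2 * (x ⬝ᵥ x) := by
  have hdiag : ∑ u, (∑ v, |J u v|) * (x u * x u) ≤ x ⬝ᵥ x :=
    Finset.sum_le_sum fun u _ => mul_le_of_le_one_left (mul_self_nonneg _) (hrow u)
  have hoff : ∑ u, ∑ v, J u v * x u * x v ≤ ∑ u, (∑ v, |J u v|) * (x u * x u) := by
    have h1 : ∑ u, ∑ v, J u v * x u * x v
        ≤ ∑ u, ∑ v, (1 / 2 * (|J u v| * (x u * x u)) + 1 / 2 * (|J v u| * (x v * x v))) :=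
      Finset.sum_le_sum fun u _ => Finset.sum_le_sum fun v _ => by
        rw [hJ v u]
        have h2 : J u v * (x u * x v) ≤ |J u v| * |x u * x v| := by
          rw [← abs_mul]; exact le_abs_self _
        have h3 : |x u * x v| ≤ 1 / 2 * (x u * x u) + 1 / 2 * (x v * x v) :=
          abs_le.2 ⟨by nlinarith [sq_nonneg (x u + x v)], by nlinarith [sq_nonneg (x u - x v)]⟩
        have h4 := mul_le_mul_of_nonneg_left h3 (abs_nonneg (J u v))
        linarith
    refine h1.trans_eq ?_
    simp only [Finset.sum_add_distrib]
    rw [Finset.sum_comm (f := fun u v => 1 / 2 * (|J v u| * (x v * x v)))]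
    simp only [← Finset.mul_sum, ← Finset.sum_mul]
    ring
  simp only [sq]
  rw [sum_interactionDir_mul hJ]
  linarith

lemma sum_interactionDir_spinVec_sq (hJ : ∀ u v, J u v = J v u) (σ : V → Bool) :
    ∑ e, (interactionDir J e ⬝ᵥ spinVec σ) ^ 2
      = 1 / 4 * ∑ u, ∑ v, |J u v| + 1 / 4 * ∑ u, ∑ v, J u v * spinVec σ u * spinVec σ v := by
  have hs : ∀ v, spinVec σ v * spinVec σ v = 1 := fun v => by
    simp only [spinVec]; split_ifs <;> norm_num
  simp only [sq]
  rw [sum_interactionDir_mul hJ]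
  simp only [hs, mul_one]

lemma bval_eq_spinVec (σ : V → Bool) (v : V) : bval (σ v) = (spinVec σ v + 1) / 2 := by
  simp only [bval, spinVec]; split_ifs <;> norm_num

/-- The `{0,1}`-valued Ising weight is proportional to a `±1`-valued one. -/
lemma exists_exp_eq_mul_isingWeight (hJ : ∀ u v, J u v = J v u) (h : V → ℝ) :
    ∃ κ > 0, ∃ h' : V → ℝ, ∀ σ : V → Bool,
      Real.exp ((1/2) * ∑ u, ∑ v, J u v * bval (σ u) * bval (σ v) + ∑ u, h u * bval (σ u))
        = κ * isingWeight (interactionDir J) 1 h' σ := by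
  refine ⟨Real.exp (1 / 8 * ∑ u, ∑ v, J u v + 1 / 2 * ∑ u, h u - 1 / 8 * ∑ u, ∑ v, |J u v|),
    Real.exp_pos _, fun u => 1 / 4 * ∑ v, J u v + 1 / 2 * h u, fun σ => ?_⟩
  rw [isingWeight, gaussTilt, ← Real.exp_add, sum_interactionDir_spinVec_sq hJ]
  congr 1
  have h1 : ∀ u v, J u v * bval (σ u) * bval (σ v) = 1 / 4 * (J u v * spinVec σ u * spinVec σ v)
      + 1 / 4 * (J u v * spinVec σ u) + 1 / 4 * (J v u * spinVec σ v) + 1 / 4 * J u v :=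
    fun u v => by
      rw [bval_eq_spinVec, bval_eq_spinVec, hJ v u]; ring
  have h2 : ∀ u, h u * bval (σ u) = 1 / 2 * (h u * spinVec σ u) + 1 / 2 * h u := fun u => by
    rw [bval_eq_spinVec]; ring
  have h3 : ∀ u, (1 / 4 * ∑ v, J u v + 1 / 2 * h u) * spinVec σ u
      = 1 / 4 * ((∑ v, J u v) * spinVec σ u) + 1 / 2 * (h u * spinVec σ u) := fun u => by ring
  simp only [dotProduct, h1, h2, h3, Finset.sum_add_distrib]
  rw [Finset.sum_comm (f := fun u v => 1 / 4 * (J v u * spinVec σ v))]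
  simp only [← Finset.mul_sum, ← Finset.sum_mul]
  ring

/-- Pinning is approximated by large external fields. -/
lemma exists_exp_sub_penalty_eq_mul_isingWeight (hJ : ∀ u v, J u v = J v u) (h : V → ℝ)
    (A : Finset V) (τ : V → Bool) (c : ℝ) :
    ∃ κ > 0, ∃ h' : V → ℝ, ∀ σ : V → Bool,
      Real.exp ((1/2) * ∑ u, ∑ v, J u v * bval (σ u) * bval (σ v) + ∑ u, h u * bval (σ u)
        - c * ∑ v ∈ A, if σ v = τ v then 0 else 1)
        = κ * isingWeight (interactionDir J) 1 h' σ := by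
  obtain ⟨κ, hκ, h', hh'⟩ := exists_exp_eq_mul_isingWeight hJ
    fun u => h u - c * if u ∈ A then 1 - 2 * bval (τ u) else 0
  refine ⟨Real.exp (-(c * ∑ v ∈ A, bval (τ v))) * κ, mul_pos (Real.exp_pos _) hκ, h',
    fun σ => ?_⟩
  rw [mul_assoc, ← hh', ← Real.exp_add]
  congr 1
  have h1 : ∀ v, (if σ v = τ v then (0 : ℝ) else 1)
      = bval (τ v) + (1 - 2 * bval (τ v)) * bval (σ v) := fun v => by
    cases σ v <;> cases τ v <;> norm_num [bval]
  have h2 : ∑ u, (if u ∈ A then 1 - 2 * bval (τ u) else 0) * bval (σ u)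
      = ∑ v ∈ A, (1 - 2 * bval (τ v)) * bval (σ v) := by
    simp only [ite_mul, zero_mul]
    rw [Finset.sum_ite_mem, Finset.univ_inter]
  simp only [h1, sub_mul, mul_assoc, Finset.sum_sub_distrib, Finset.sum_add_distrib,
    ← Finset.mul_sum] at h2 ⊢
  rw [h2]
  ring

lemma tendsto_exp_sub_penalty (A : Finset V) (τ σ : V → Bool) (E : ℝ) :
    Tendsto (fun n : ℕ => Real.exp (E - n * ∑ v ∈ A, if σ v = τ v then 0 else 1)) atTop
      (𝓝 (if ∀ v ∈ A, σ v = τ v then Real.exp E else 0)) := by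
  split_ifs with hσ
  · rw [Finset.sum_eq_zero fun v hv => if_pos (hσ v hv)]
    simp
  · push Not at hσ
    obtain ⟨v, hv, hne⟩ := hσ
    have hpos : (0 : ℝ) < ∑ v ∈ A, if σ v = τ v then 0 else 1 :=
      Finset.sum_pos' (fun u _ => by split_ifs <;> norm_num) ⟨v, hv, by simp [hne]⟩
    exact Real.tendsto_exp_atBot.comp (tendsto_atBot_add_const_left _ E
      (tendsto_neg_atTop_atBot.comp (tendsto_natCast_atTop_atTop.atTop_mul_const hpos)))

lemma sum_abs_le_one_of_degree_le (G : SimpleGraph V) [DecidableRel G.Adj] {Δ : ℕ}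
    (hdeg : ∀ v, G.degree v ≤ Δ) {β : ℝ} (hβ : 0 < β) (hsmall : β ≤ 1 / (Δ : ℝ))
    (hJbd : ∀ u v, |J u v| ≤ β) (hJsupp : ∀ u v, ¬ G.Adj u v → J u v = 0) (u : V) :
    ∑ v, |J u v| ≤ 1 := by
  have hΔ : (0 : ℝ) < Δ := one_div_pos.1 (hβ.trans_le hsmall)
  calc ∑ v, |J u v| = ∑ v ∈ G.neighborFinset u, |J u v| := by
        refine (Finset.sum_subset (Finset.subset_univ _) fun v _ hv => ?_).symm
        rw [hJsupp u v (by simpa using hv), abs_zero]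
    _ ≤ ∑ _v ∈ G.neighborFinset u, β := Finset.sum_le_sum fun v _ => hJbd u v
    _ = G.degree u * β := by simp
    _ ≤ Δ * β := mul_le_mul_of_nonneg_right (Nat.cast_le.2 (hdeg u)) hβ.le
    _ ≤ 1 := by rwa [le_div_iff₀ hΔ, mul_comm] at hsmall

/-- The approximate tensorization bounds pass to pointwise limits of Ising probability vectors. -/
lemma tensorization_of_tendsto {K : Type*} [Fintype K] {a : K → V → ℝ}
    (ha : ∀ j, ∑ i, (if i = j then 0 else |∑ k, a k i * a k j|) ≤ 1 / 4)
    (ha' : ∀ x : V → ℝ, ∑ k, (a k ⬝ᵥ x) ^ 2 ≤ 1 / 2 * (x ⬝ᵥ x))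
    {w : ℕ → (V → Bool) → ℝ} {w' : (V → Bool) → ℝ}
    (hw : ∀ n, ∃ κ > 0, ∃ h : V → ℝ, ∀ σ, w n σ = κ * isingWeight a 1 h σ)
    (hlim : ∀ σ, Tendsto (fun n => w n σ) atTop (𝓝 (w' σ))) (hpos : 0 < ∑ σ, w' σ) :
    (∀ f, pVar (fun σ => w' σ / ∑ ρ, w' ρ) f
      ≤ 2 * ∑ i, siteVarTerm (fun σ => w' σ / ∑ ρ, w' ρ) f i) ∧
    ∀ f, (∀ σ, 0 ≤ f σ) → pEnt (fun σ => w' σ / ∑ ρ, w' ρ) f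
      ≤ 2 * ∑ i, siteEntTerm (fun σ => w' σ / ∑ ρ, w' ρ) f i := by
  choose κ hκ h hwκ using hw
  have hwpos : ∀ n σ, 0 < w n σ := fun n σ => by
    rw [hwκ]; exact mul_pos (hκ n) (isingWeight_pos 1 (h n) σ)
  have hZ : ∀ n, 0 < ∑ ρ, w n ρ := fun n =>
    Finset.sum_pos (fun ρ _ => hwpos n ρ) Finset.univ_nonempty
  let p : ℕ → (V → Bool) → ℝ := fun n σ => w n σ / ∑ ρ, w n ρ
  have hppos : ∀ n σ, 0 < p n σ := fun n σ => div_pos (hwpos n σ) (hZ n)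
  have hp : ∀ σ, Tendsto (fun n => p n σ) atTop (𝓝 (w' σ / ∑ ρ, w' ρ)) := fun σ =>
    (hlim σ).div (tendsto_finsetSum _ fun ρ _ => hlim ρ) hpos.ne'
  have hpeq : ∀ n, p n = fun σ => κ n / (∑ ρ, w n ρ) * isingWeight a 1 (h n) σ := fun n => by
    ext σ
    simp only [p]
    rw [hwκ n σ, div_mul_eq_mul_div]
  have hc : ∀ n, κ n / (∑ ρ, w n ρ) * ∑ σ, isingWeight a 1 (h n) σ = 1 := fun n => by
    rw [div_mul_eq_mul_div, Finset.mul_sum, div_eq_one_iff_eq (hZ n).ne']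
    exact Finset.sum_congr rfl fun σ _ => (hwκ n σ).symm
  refine ⟨fun f => ?_, fun f hf => ?_⟩
  · refine le_of_tendsto_of_tendsto' (tendsto_pVar hp f)
      ((tendsto_finsetSum Finset.univ fun i _ => tendsto_siteVarTerm hppos hp f i).const_mul 2)
      fun n => ?_
    simp only [hpeq]
    exact pVar_isingWeight_le ha (hc n) f
  · let F : ℕ → (V → Bool) → ℝ := fun n σ => f σ + 1 / ((n : ℝ) + 1)
    have hF : ∀ σ, Tendsto (fun n => F n σ) atTop (𝓝 (f σ)) := fun σ => by
      simpa [F] using tendsto_one_div_add_atTop_nhds_zero_nat.const_add (f σ)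
    have hFpos : ∀ n σ, 0 < F n σ := fun n σ =>
      add_pos_of_nonneg_of_pos (hf σ) Nat.one_div_pos_of_nat
    have hM : ∀ n σ, |F n σ| ≤ ‖f‖ + 1 := fun n σ => by
      rw [abs_of_pos (hFpos n σ)]
      exact add_le_add ((le_abs_self _).trans (norm_le_pi_norm f σ))
        (Nat.one_div_le_one_div n.zero_le |>.trans (by simp))
    refine le_of_tendsto_of_tendsto' (tendsto_pEnt hp hF)
      ((tendsto_finsetSum Finset.univ fun i _ =>
        tendsto_siteEntTerm hppos hp hF hM i).const_mul 2) fun n => ?_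
    simp only [hpeq]
    exact pEnt_isingWeight_le ha ha' (hc n) (hFpos n)

end Interaction

end Helpers

/-- **Approximate tensorization at high temperature.**
An Ising model on `{0,1}^V` (possibly with a pinned subset `A`) with pair interactions
`|β_{uv}| ≤ β ≤ 1/Δ` on a graph of maximal degree `Δ` and arbitrary external field
satisfies approximate tensorization of variance and of entropy with constant `2`. -/
theorem high_temp_approximate_tensorization
    (G : SimpleGraph V) [DecidableRel G.Adj] (Δ : ℕ) (hdeg : ∀ v, G.degree v ≤ Δ)
    (β : ℝ) (hβ : 0 < β) (hsmall : β ≤ 1 / (Δ : ℝ))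
    (J : V → V → ℝ) (hJsymm : ∀ u v, J u v = J v u)
    (hJbd : ∀ u v, |J u v| ≤ β) (hJsupp : ∀ u v, ¬ G.Adj u v → J u v = 0)
    (h : V → ℝ) (A : Finset V) (τ : V → Bool) :
    ∃ Zn : ℝ, 0 < Zn ∧
      Zn = ∑ σ : V → Bool, (if ∀ v ∈ A, σ v = τ v then
          Real.exp ((1/2) * ∑ u, ∑ v, J u v * bval (σ u) * bval (σ v)
            + ∑ u, h u * bval (σ u)) else 0) ∧
      (∀ f : (V → Bool) → ℝ,
        pVar (fun σ => (if ∀ v ∈ A, σ v = τ v then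
            Real.exp ((1/2) * ∑ u, ∑ v, J u v * bval (σ u) * bval (σ v)
              + ∑ u, h u * bval (σ u)) else 0) / Zn) f
          ≤ 2 * ∑ i, siteVarTerm (fun σ => (if ∀ v ∈ A, σ v = τ v then
              Real.exp ((1/2) * ∑ u, ∑ v, J u v * bval (σ u) * bval (σ v)
                + ∑ u, h u * bval (σ u)) else 0) / Zn) f i) ∧
      (∀ f : (V → Bool) → ℝ, (∀ σ, 0 ≤ f σ) →
        pEnt (fun σ => (if ∀ v ∈ A, σ v = τ v then
            Real.exp ((1/2) * ∑ u, ∑ v, J u v * bval (σ u) * bval (σ v)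
              + ∑ u, h u * bval (σ u)) else 0) / Zn) f
          ≤ 2 * ∑ i, siteEntTerm (fun σ => (if ∀ v ∈ A, σ v = τ v then
              Real.exp ((1/2) * ∑ u, ∑ v, J u v * bval (σ u) * bval (σ v)
                + ∑ u, h u * bval (σ u)) else 0) / Zn) f i) := by
  have hrow := sum_abs_le_one_of_degree_le G hdeg hβ hsmall hJbd hJsupp
  have hnonneg : ∀ σ : V → Bool, 0 ≤ (if ∀ v ∈ A, σ v = τ v then
      Real.exp ((1/2) * ∑ u, ∑ v, J u v * bval (σ u) * bval (σ v)
        + ∑ u, h u * bval (σ u)) else 0) := fun σ => by split_ifs <;> positivity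
  have hpos : 0 < ∑ σ : V → Bool, (if ∀ v ∈ A, σ v = τ v then
      Real.exp ((1/2) * ∑ u, ∑ v, J u v * bval (σ u) * bval (σ v)
        + ∑ u, h u * bval (σ u)) else 0) :=
    Finset.sum_pos' (fun σ _ => hnonneg σ)
      ⟨τ, Finset.mem_univ τ, by rw [if_pos fun _ _ => rfl]; exact Real.exp_pos _⟩
  exact ⟨_, hpos, rfl, tensorization_of_tendsto (sum_abs_sum_interactionDir_le hJsymm hrow)
    (sum_interactionDir_sq_le hJsymm hrow)
    (fun n => exists_exp_sub_penalty_eq_mul_isingWeight hJsymm h A τ n)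
    (fun σ => tendsto_exp_sub_penalty A τ σ _) hpos⟩


end
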